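/- Given integers N ≥ 1 and a real number d > 1, there exists a constant B = B(N,d) > 1 with the following property: for every multicritical circle map f with irrational rotation number having at most N critical points, all of whose criticalities are at most d, and every critical point c of f, there exists n₀ = n₀(f) ∈ ℕ such that for all n ≥ n₀ the scaling ratio around c satisfies B^{-1} ≤ |I_{n+1}(c)| / |I_n(c)| ≤ B. -/

import Mathlib

open Set Filter Topology
open scoped ENNReal

noncomputable section

namespace MCircle

/-- A lift of an orientation-preserving `C³` circle homeomorphism of `S¹ = ℝ/ℤ`:
a `C³`, strictly increasing map commuting with the unit translation. -/
structure IsCircleMapLift (f : ℝ → ℝ) : Prop where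
  smooth : ContDiff ℝ 3 f
  mono : StrictMono f
  periodic : ∀ x : ℝ, f (x + 1) = f x + 1

/-- `c` is a non-flat (power-law) critical point of `f` of criticality `d > 1`:
near `c` we have `f x = f c + φ x * |φ x| ^ (d - 1)` for a `C³` diffeomorphism `φ`
of a neighbourhood `W` of `c` with `φ c = 0`. -/
def IsNonFlatCritPt (f : ℝ → ℝ) (c d : ℝ) : Prop :=
  1 < d ∧ ∃ (W : Set ℝ) (φ : ℝ → ℝ), IsOpen W ∧ c ∈ W ∧
    ContDiffOn ℝ 3 φ W ∧ φ c = 0 ∧ (∀ x ∈ W, deriv φ x ≠ 0) ∧ InjOn φ W ∧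
    ∀ x ∈ W, f x = f c + φ x * |φ x| ^ (d - 1)

/-- `f` is (a lift of) a multicritical circle map: the set of critical points of the
induced circle map, represented in `[0,1)`, is the nonempty finite set `C`, and each
critical point `c ∈ C` is non-flat of criticality `dc c`. -/
def IsMulticriticalLift (f : ℝ → ℝ) (C : Finset ℝ) (dc : ℝ → ℝ) : Prop :=
  IsCircleMapLift f ∧ C.Nonempty ∧ (↑C : Set ℝ) ⊆ Ico (0 : ℝ) 1 ∧
    (∀ x : ℝ, deriv f x = 0 ↔ ∃ c ∈ C, ∃ k : ℤ, x = c + (k : ℝ)) ∧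
    ∀ c ∈ C, IsNonFlatCritPt f c (dc c)

/-- The lift `f` has (translation) rotation number `ρ`. -/
def HasRotNumber (f : ℝ → ℝ) (ρ : ℝ) : Prop :=
  Tendsto (fun n : ℕ => f^[n] 0 / (n : ℝ)) atTop (𝓝 ρ)

/-- `f` is (a lift of) a multicritical circle map with critical set `C` (criticalities
`dc`) and irrational rotation number `ρ`, the lift being normalized so that `ρ ∈ (0,1)`. -/
def GoodMap (f : ℝ → ℝ) (C : Finset ℝ) (dc : ℝ → ℝ) (ρ : ℝ) : Prop :=
  IsMulticriticalLift f C dc ∧ HasRotNumber f ρ ∧ Irrational ρ ∧ ρ ∈ Ioo (0 : ℝ) 1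

/-- The Gauss map. -/
def gaussMap (x : ℝ) : ℝ := Int.fract x⁻¹

/-- The partial quotients `aₙ` of the continued fraction expansion
`ρ = [a₀, a₁, …] = 1/(a₀ + 1/(a₁ + ⋯))`. -/
def cfA (ρ : ℝ) (n : ℕ) : ℕ := ⌊(gaussMap^[n] (Int.fract ρ))⁻¹⌋₊

/-- The denominators `qₙ` of the convergents of `ρ` (the return times):
`q₀ = 1`, `q₁ = a₀`, `q_{n+2} = a_{n+1} q_{n+1} + qₙ`. -/
def qden (ρ : ℝ) : ℕ → ℕ
  | 0 => 1
  | 1 => cfA ρ 0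
  | n + 2 => cfA ρ (n + 1) * qden ρ (n + 1) + qden ρ n

/-- The numerators `pₙ` of the convergents of `ρ`:
`p₀ = 0`, `p₁ = 1`, `p_{n+2} = a_{n+1} p_{n+1} + pₙ`. -/
def pnum (ρ : ℝ) : ℕ → ℕ
  | 0 => 0
  | 1 => 1
  | n + 2 => cfA ρ (n + 1) * pnum ρ (n + 1) + pnum ρ n

/-- The lift representative of the `n`-th closest return `f^{qₙ}(x)`,
normalized (by the integer `pₙ`) to lie at distance less than one from `x`. -/
def retPt (f : ℝ → ℝ) (ρ x : ℝ) (n : ℕ) : ℝ := f^[qden ρ n] x - (pnum ρ n : ℝ)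

/-- The arc `Iₙ(x)`, with endpoints `x` and `f^{qₙ}(x)` and containing `f^{q_{n+2}}(x)`,
realized as an interval in the lift. -/
def arcI (f : ℝ → ℝ) (ρ x : ℝ) (n : ℕ) : Set ℝ := uIcc x (retPt f ρ x n)

/-- The length `|Iₙ(x)|`. -/
def arcLen (f : ℝ → ℝ) (ρ x : ℝ) (n : ℕ) : ℝ := |retPt f ρ x n - x|

/-- The length `|f^j(Iₙ(x))|`. -/
def arcImgLen (f : ℝ → ℝ) (ρ x : ℝ) (n j : ℕ) : ℝ :=
  |f^[j] (retPt f ρ x n) - f^[j] x|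

/-- Indices for the atoms of the `n`-th dynamical partition
`𝒫ₙ(x) = {fⁱ(Iₙ(x)) : 0 ≤ i ≤ q_{n+1}-1} ∪ {f^j(I_{n+1}(x)) : 0 ≤ j ≤ qₙ-1}`. -/
abbrev AtomIdx (ρ : ℝ) (n : ℕ) : Type :=
  {i : ℕ // i < qden ρ (n + 1)} ⊕ {j : ℕ // j < qden ρ n}

/-- Left endpoint (in the lift) of an atom of `𝒫ₙ(x)`. -/
def atomL (f : ℝ → ℝ) (ρ x : ℝ) (n : ℕ) : AtomIdx ρ n → ℝ
  | Sum.inl i => min (f^[i.1] x) (f^[i.1] (retPt f ρ x n))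
  | Sum.inr j => min (f^[j.1] x) (f^[j.1] (retPt f ρ x (n + 1)))

/-- Right endpoint (in the lift) of an atom of `𝒫ₙ(x)`. -/
def atomR (f : ℝ → ℝ) (ρ x : ℝ) (n : ℕ) : AtomIdx ρ n → ℝ
  | Sum.inl i => max (f^[i.1] x) (f^[i.1] (retPt f ρ x n))
  | Sum.inr j => max (f^[j.1] x) (f^[j.1] (retPt f ρ x (n + 1)))

/-- Length of an atom of `𝒫ₙ(x)`. -/
def atomLen (f : ℝ → ℝ) (ρ x : ℝ) (n : ℕ) (A : AtomIdx ρ n) : ℝ :=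
  atomR f ρ x n A - atomL f ρ x n A

/-- Two lift points represent the same point of the circle `ℝ/ℤ`. -/
def SameCirclePt (a b : ℝ) : Prop := ∃ m : ℤ, a = b + (m : ℝ)

/-- Two atoms of `𝒫ₙ(x)` are adjacent: they are distinct and share an endpoint
on the circle. -/
def AdjacentAtoms (f : ℝ → ℝ) (ρ x : ℝ) (n : ℕ) (A B : AtomIdx ρ n) : Prop :=
  A ≠ B ∧ ∃ p ∈ ({atomL f ρ x n A, atomR f ρ x n A} : Set ℝ),
    ∃ q ∈ ({atomL f ρ x n B, atomR f ρ x n B} : Set ℝ), SameCirclePt p q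

/-- `A` is the left neighbour of `Δ` in `𝒫ₙ(x)`. -/
def IsLeftNbr (f : ℝ → ℝ) (ρ x : ℝ) (n : ℕ) (A Δ : AtomIdx ρ n) : Prop :=
  A ≠ Δ ∧ SameCirclePt (atomR f ρ x n A) (atomL f ρ x n Δ)

/-- `B` is the right neighbour of `Δ` in `𝒫ₙ(x)`. -/
def IsRightNbr (f : ℝ → ℝ) (ρ x : ℝ) (n : ℕ) (B Δ : AtomIdx ρ n) : Prop :=
  B ≠ Δ ∧ SameCirclePt (atomL f ρ x n B) (atomR f ρ x n Δ)

/-- The arc `f^j(Δ)` is contained (as a circle arc) in some element of `𝒫ₙ(x)`. -/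
def ImgInAtom (f : ℝ → ℝ) (ρ x : ℝ) (n j : ℕ) (Δ : AtomIdx ρ n) : Prop :=
  ∃ E : AtomIdx ρ n, ∃ m : ℤ,
    atomL f ρ x n E + (m : ℝ) ≤ f^[j] (atomL f ρ x n Δ) ∧
    f^[j] (atomR f ρ x n Δ) ≤ atomR f ρ x n E + (m : ℝ)

/-- An atom of `𝒫ₙ(x)` as a subset of the circle `ℝ/ℤ`. -/
def atomSetC (f : ℝ → ℝ) (ρ x : ℝ) (n : ℕ) (A : AtomIdx ρ n) : Set (AddCircle (1 : ℝ)) :=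
  (fun y : ℝ => (y : AddCircle (1 : ℝ))) '' Icc (atomL f ρ x n A) (atomR f ρ x n A)

/-- The interval `Tₙ = I_{n+1} ∪ Iₙ ∪ f^{qₙ}(Iₙ)`, realized in the lift. -/
def Tset (f : ℝ → ℝ) (ρ x : ℝ) (n : ℕ) : Set ℝ :=
  arcI f ρ x (n + 1) ∪ arcI f ρ x n ∪
    (fun z => f^[qden ρ n] z - (pnum ρ n : ℝ)) '' arcI f ρ x n

/-- `j` is a critical time: `f^j(Tₙ)` contains a critical point of `f` (mod 1). -/
def IsCritTime (f : ℝ → ℝ) (ρ x : ℝ) (C : Finset ℝ) (n j : ℕ) : Prop :=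
  ∃ c ∈ C, ∃ m : ℤ, c + (m : ℝ) ∈ f^[j] '' Tset f ρ x n

/-- The cross-ratio `[M,T] = |L||R|/(|L∪M||M∪R|)` of the configuration
`M = [b,c] ⋐ T = [a,d]` (so `L = [a,b]`, `R = [c,d]`). -/
def crossRatio (a b c d : ℝ) : ℝ := ((b - a) * (d - c)) / ((c - a) * (d - b))

/-- The cross-ratio distortion `CrD(g; M, T)` of `g` on the configuration
`M = [b,c] ⋐ T = [a,d]`. -/
def crD (g : ℝ → ℝ) (a b c d : ℝ) : ℝ :=
  crossRatio (g a) (g b) (g c) (g d) / crossRatio a b c d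

/-- The Schwarzian derivative `Sg = g'''/g' - (3/2)(g''/g')²`. -/
def schwarzian (g : ℝ → ℝ) (x : ℝ) : ℝ :=
  iteratedDeriv 3 g x / deriv g x - (3 / 2) * (iteratedDeriv 2 g x / deriv g x) ^ 2

/-- `g` is a diffeomorphism on `S` with distortion bounded by `K`. -/
def DiffeoWithDistortionLE (g : ℝ → ℝ) (S : Set ℝ) (K : ℝ) : Prop :=
  ContDiffOn ℝ 1 g S ∧ InjOn g S ∧ (∀ x ∈ S, deriv g x ≠ 0) ∧
    ∀ x ∈ S, ∀ y ∈ S, |deriv g x| ≤ K * |deriv g y|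

/-- `g` is a diffeomorphism on `S` with negative Schwarzian derivative. -/
def NegSchwarzDiffeoOn (g : ℝ → ℝ) (S : Set ℝ) : Prop :=
  ContDiffOn ℝ 3 g S ∧ InjOn g S ∧ ∀ x ∈ S, deriv g x ≠ 0 ∧ schwarzian g x < 0

/-- The local quasi-symmetric distortion
`σ_h(x) = lim_{δ→0} limsup_{|t|≤δ} |h(x+t)-h(x)|/|h(x)-h(x-t)|` of a circle
homeomorphism lift `h`, with values in `[0,∞]`. -/
def qsDistortion (h : ℝ → ℝ) (x : ℝ) : ℝ≥0∞ :=
  Filter.limsup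
    (fun t : ℝ => ENNReal.ofReal (|h (x + t) - h x| / |h x - h (x - t)|))
    (𝓝[≠] (0 : ℝ))

end MCircle


namespace MCircle

/-! ### Closest returns of an irrational rotation -/

/-- `q * ρ - p > 0` is a closest return of the rotation by `ρ`, with the next closest return
`Q * ρ - P < 0` on the other side. -/
structure IsReturnPair (ρ : ℝ) (q : ℕ) (p : ℤ) (Q : ℕ) (P : ℤ) : Prop where
  q_pos : 0 < q
  q_le : q ≤ Q
  pos : 0 < (q : ℝ) * ρ - p
  lt_one : (q : ℝ) * ρ - p < 1
  next_neg : (Q : ℝ) * ρ - P < 0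
  next_le : (P : ℝ) - Q * ρ ≤ q * ρ - p
  best : ∀ j : ℕ, 0 < j → j < Q → ∀ l : ℤ, (q : ℝ) * ρ - p ≤ |(j : ℝ) * ρ - l|

section ContinuedFraction

variable {ρ : ℝ}

/-- The signed displacement of the `n`-th closest return. -/
def cfDisp (ρ : ℝ) (n : ℕ) : ℝ := (qden ρ n : ℝ) * ρ - pnum ρ n

lemma gauss_iterate_mem (hirr : Irrational ρ) (n : ℕ) :
    Irrational (gaussMap^[n] (Int.fract ρ)) ∧
      gaussMap^[n] (Int.fract ρ) ∈ Ioo (0 : ℝ) 1 := by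
  have key : ∀ y : ℝ, Irrational y → Irrational (Int.fract y) ∧ Int.fract y ∈ Ioo (0 : ℝ) 1 := by
    intro y hy
    have h1 : Irrational (Int.fract y) := by
      rw [Int.fract]; exact hy.sub_intCast _
    exact ⟨h1, lt_of_le_of_ne (Int.fract_nonneg y) h1.ne_zero.symm, Int.fract_lt_one y⟩
  induction n with
  | zero => exact key ρ hirr
  | succ n ih =>
    rw [Function.iterate_succ_apply']
    exact key _ ih.1.inv

lemma cfA_spec (hirr : Irrational ρ) (n : ℕ) :
    1 ≤ cfA ρ n ∧ (gaussMap^[n] (Int.fract ρ))⁻¹ =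
      cfA ρ n + gaussMap^[n + 1] (Int.fract ρ) := by
  obtain ⟨-, h0, h1⟩ := gauss_iterate_mem hirr n
  have hinv : 1 < (gaussMap^[n] (Int.fract ρ))⁻¹ := (one_lt_inv₀ h0).2 h1
  refine ⟨Nat.one_le_floor_iff _ |>.2 hinv.le, ?_⟩
  rw [Function.iterate_succ_apply', gaussMap, cfA,
    natCast_floor_eq_intCast_floor (by positivity)]
  exact (Int.floor_add_fract _).symm

lemma cfDisp_succ (hirr : Irrational ρ) (hρ : ρ ∈ Ioo (0 : ℝ) 1) (n : ℕ) :
    cfDisp ρ (n + 1) = -(gaussMap^[n + 1] (Int.fract ρ)) * cfDisp ρ n := by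
  have hfr : Int.fract ρ = ρ := Int.fract_eq_self.2 ⟨hρ.1.le, hρ.2⟩
  induction n with
  | zero =>
    have h := (cfA_spec hirr 0).2
    simp only [Function.iterate_zero, id, hfr] at h
    have h0 : ρ ≠ 0 := hρ.1.ne'
    simp only [cfDisp, qden, pnum, hfr]
    have h2 : (1 : ℝ) = (cfA ρ 0 + gaussMap^[0 + 1] ρ) * ρ := by rw [← h]; field_simp
    push_cast
    linear_combination -h2
  | succ n ih =>
    have h := (cfA_spec hirr (n + 1)).2
    have h0 := (gauss_iterate_mem hirr (n + 1)).2.1.ne'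
    set g := gaussMap^[n + 1] (Int.fract ρ)
    have h2 : (1 : ℝ) = (cfA ρ (n + 1) + gaussMap^[n + 1 + 1] (Int.fract ρ)) * g := by
      rw [← h]; field_simp
    have hrec : cfDisp ρ (n + 1 + 1) = cfA ρ (n + 1) * cfDisp ρ (n + 1) + cfDisp ρ n := by
      simp only [cfDisp, qden, pnum]; push_cast; ring
    rw [hrec, ih]
    linear_combination cfDisp ρ n * h2

lemma cfDisp_sign (hirr : Irrational ρ) (hρ : ρ ∈ Ioo (0 : ℝ) 1) (n : ℕ) :
    0 < (-1) ^ n * cfDisp ρ n := by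
  induction n with
  | zero => simpa [cfDisp, qden, pnum] using hρ.1
  | succ n ih =>
    rw [cfDisp_succ hirr hρ, pow_succ]
    have := mul_pos (gauss_iterate_mem hirr (n + 1)).2.1 ih
    linarith

lemma abs_cfDisp (hirr : Irrational ρ) (hρ : ρ ∈ Ioo (0 : ℝ) 1) (n : ℕ) :
    |cfDisp ρ n| = (-1) ^ n * cfDisp ρ n := by
  rw [← abs_of_pos (cfDisp_sign hirr hρ n), abs_mul, abs_pow, abs_neg, abs_one, one_pow, one_mul]

lemma abs_cfDisp_succ_le (hirr : Irrational ρ) (hρ : ρ ∈ Ioo (0 : ℝ) 1) (n : ℕ) :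
    |cfDisp ρ (n + 1)| ≤ |cfDisp ρ n| := by
  have h := (gauss_iterate_mem hirr (n + 1)).2
  rw [cfDisp_succ hirr hρ, abs_mul, abs_neg, abs_of_pos h.1]
  exact mul_le_of_le_one_left (abs_nonneg _) h.2.le

lemma abs_cfDisp_add_two_le (hirr : Irrational ρ) (hρ : ρ ∈ Ioo (0 : ℝ) 1) (n : ℕ) :
    |cfDisp ρ (n + 2)| ≤ |cfDisp ρ n| / 2 := by
  have hrec : cfDisp ρ (n + 2) = cfA ρ (n + 1) * cfDisp ρ (n + 1) + cfDisp ρ n := by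
    simp only [cfDisp, qden, pnum]; push_cast; ring
  have ha : (1 : ℝ) ≤ cfA ρ (n + 1) := by exact_mod_cast (cfA_spec hirr (n + 1)).1
  have h1 : |cfDisp ρ (n + 2)| ≤ |cfDisp ρ (n + 1)| := abs_cfDisp_succ_le hirr hρ (n + 1)
  have h2 := cfDisp_sign hirr hρ (n + 1)
  rw [abs_cfDisp hirr hρ] at h1 ⊢
  rw [abs_cfDisp hirr hρ] at h1 ⊢
  rw [hrec] at h1 ⊢
  have e1 : (-1 : ℝ) ^ (n + 1) = -(-1) ^ n := by ring
  have e2 : (-1 : ℝ) ^ (n + 2) = (-1) ^ n := by ring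
  rw [e1] at h1 h2
  rw [e2] at h1 ⊢
  nlinarith [mul_le_mul_of_nonneg_right ha h2.le]

lemma abs_cfDisp_lt_one (hirr : Irrational ρ) (hρ : ρ ∈ Ioo (0 : ℝ) 1) (n : ℕ) :
    |cfDisp ρ n| < 1 := by
  induction n with
  | zero => simpa [cfDisp, qden, pnum, abs_of_pos hρ.1] using hρ.2
  | succ n ih => exact (abs_cfDisp_succ_le hirr hρ n).trans_lt ih

lemma qden_pos (hirr : Irrational ρ) (n : ℕ) : 0 < qden ρ n := by
  induction n using Nat.twoStepInduction with
  | zero => simp [qden]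
  | one => exact (cfA_spec hirr 0).1
  | more n h1 h2 => simp only [qden]; omega

lemma qden_le_succ (hirr : Irrational ρ) (n : ℕ) : qden ρ n ≤ qden ρ (n + 1) := by
  cases n with
  | zero => simpa [qden] using (cfA_spec hirr 0).1
  | succ n =>
    have := (cfA_spec hirr (n + 1)).1
    simp only [qden]
    nlinarith [qden_pos hirr (n + 1)]

lemma qden_pnum_det (ρ : ℝ) (n : ℕ) :
    (qden ρ (n + 1) : ℤ) * pnum ρ n - qden ρ n * pnum ρ (n + 1) = -(-1) ^ n := by
  induction n with
  | zero => simp [qden, pnum]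
  | succ n ih =>
    simp only [qden, pnum] at ih ⊢
    push_cast
    linear_combination -ih

lemma cfDisp_best (hirr : Irrational ρ) (hρ : ρ ∈ Ioo (0 : ℝ) 1) (n j : ℕ) (hj : 0 < j)
    (hjn : j < qden ρ (n + 1)) (l : ℤ) : |cfDisp ρ n| ≤ |(j : ℝ) * ρ - l| := by
  have hdet := qden_pnum_det ρ n
  have hs := cfDisp_sign hirr hρ n
  have hs' := cfDisp_sign hirr hρ (n + 1)
  rw [abs_cfDisp hirr hρ]
  set ε : ℤ := (-1) ^ n with hε
  have hεε : ε * ε = 1 := by rw [hε, ← mul_pow]; simp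
  set r : ℤ := -ε * (j * -(pnum ρ (n + 1) : ℤ) + l * qden ρ (n + 1)) with hr
  set s : ℤ := -ε * (j * (pnum ρ n : ℤ) - l * qden ρ n) with hsdef
  have e1 : (j : ℤ) = r * qden ρ n + s * qden ρ (n + 1) := by
    rw [hr, hsdef]; linear_combination ε * (j : ℤ) * hdet - (j : ℤ) * hεε
  have e2 : l = r * pnum ρ n + s * pnum ρ (n + 1) := by
    rw [hr, hsdef]; linear_combination ε * l * hdet - l * hεε
  have e3 : (j : ℝ) * ρ - l = r * cfDisp ρ n + s * cfDisp ρ (n + 1) := by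
    have e1' : (j : ℝ) = r * qden ρ n + s * qden ρ (n + 1) := by exact_mod_cast e1
    have e2' : (l : ℝ) = r * pnum ρ n + s * pnum ρ (n + 1) := by exact_mod_cast e2
    rw [e1', e2', cfDisp, cfDisp]; ring
  have hq := qden_pos hirr n
  have hq' := qden_pos hirr (n + 1)
  have e4 : |(j : ℝ) * ρ - l| =
      |(r : ℝ) * ((-1) ^ n * cfDisp ρ n) - s * ((-1) ^ (n + 1) * cfDisp ρ (n + 1))| := by
    rw [e3, pow_succ]
    have : (r : ℝ) * ((-1) ^ n * cfDisp ρ n) - s * ((-1) ^ n * -1 * cfDisp ρ (n + 1)) =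
      (-1) ^ n * (r * cfDisp ρ n + s * cfDisp ρ (n + 1)) := by ring
    rw [this, abs_mul, abs_pow, abs_neg, abs_one, one_pow, one_mul]
  rw [e4]
  zify at hj hjn hq hq'
  rcases lt_trichotomy s 0 with h | h | h
  · have hr1 : 1 ≤ r := by
      by_contra hcon
      have : r ≤ 0 := by omega
      nlinarith
    have hr1' : (1 : ℝ) ≤ r := by exact_mod_cast hr1
    have hs1' : (s : ℝ) ≤ 0 := by exact_mod_cast h.le
    refine le_trans ?_ (le_abs_self _)
    nlinarith
  · have hr1 : 1 ≤ r := by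
      by_contra hcon
      have : r ≤ 0 := by omega
      rw [h] at e1
      nlinarith
    have hr1' : (1 : ℝ) ≤ r := by exact_mod_cast hr1
    refine le_trans ?_ (le_abs_self _)
    rw [h]; push_cast
    nlinarith
  · have hr1 : r ≤ -1 := by
      by_contra hcon
      have : 0 ≤ r := by omega
      nlinarith
    have hr1' : (r : ℝ) ≤ -1 := by exact_mod_cast hr1
    have hs1' : (0 : ℝ) ≤ s := by exact_mod_cast h.le
    refine le_trans ?_ (neg_le_abs _)
    nlinarith

lemma isReturnPair_of_even (hirr : Irrational ρ) (hρ : ρ ∈ Ioo (0 : ℝ) 1) {n : ℕ}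
    (hn : Even n) :
    IsReturnPair ρ (qden ρ n) (pnum ρ n) (qden ρ (n + 1)) (pnum ρ (n + 1)) := by
  have hs := cfDisp_sign hirr hρ n
  have hs' := cfDisp_sign hirr hρ (n + 1)
  have ha := abs_cfDisp hirr hρ n
  have ha' := abs_cfDisp hirr hρ (n + 1)
  have hle := abs_cfDisp_succ_le hirr hρ n
  have hlt := abs_cfDisp_lt_one hirr hρ n
  have hb := cfDisp_best hirr hρ n
  rw [ha'] at hle
  rw [ha] at hle hlt hb
  rw [pow_succ] at hs' hle
  rw [hn.neg_one_pow] at hs hs' hle hlt hb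
  simp only [one_mul, cfDisp] at hs hs' hle hlt hb
  refine ⟨qden_pos hirr n, qden_le_succ hirr n, ?_, ?_, ?_, ?_, ?_⟩ <;> push_cast
  · linarith
  · linarith
  · linarith
  · linarith
  · exact hb

lemma isReturnPair_of_odd (hirr : Irrational ρ) (hρ : ρ ∈ Ioo (0 : ℝ) 1) {n : ℕ}
    (hn : Odd n) :
    IsReturnPair (-ρ) (qden ρ n) (-pnum ρ n) (qden ρ (n + 1)) (-pnum ρ (n + 1)) := by
  have hs := cfDisp_sign hirr hρ n
  have hs' := cfDisp_sign hirr hρ (n + 1)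
  have ha := abs_cfDisp hirr hρ n
  have ha' := abs_cfDisp hirr hρ (n + 1)
  have hle := abs_cfDisp_succ_le hirr hρ n
  have hlt := abs_cfDisp_lt_one hirr hρ n
  have hb := cfDisp_best hirr hρ n
  rw [ha'] at hle
  rw [ha] at hle hlt hb
  rw [pow_succ] at hs' hle
  rw [hn.neg_one_pow] at hs hs' hle hlt hb
  simp only [cfDisp] at hs hs' hle hlt hb
  refine ⟨qden_pos hirr n, qden_le_succ hirr n, ?_, ?_, ?_, ?_, ?_⟩ <;> push_cast
  · linarith
  · linarith
  · linarith
  · linarith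
  · intro j hj hjn l
    have := hb j hj hjn (-l)
    rw [← abs_neg] at this
    convert (le_of_eq_of_le ?_ this) using 2
    · push_cast; ring
    · ring

lemma abs_cfDisp_two_mul_add_le (hirr : Irrational ρ) (hρ : ρ ∈ Ioo (0 : ℝ) 1) (i n : ℕ) :
    |cfDisp ρ (2 * n + i)| ≤ (1 / 2) ^ n := by
  induction n with
  | zero => simpa using (abs_cfDisp_lt_one hirr hρ _).le
  | succ n ih =>
    have := abs_cfDisp_add_two_le hirr hρ (2 * n + i)
    rw [show 2 * (n + 1) + i = 2 * n + i + 2 by ring, pow_succ]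
    linarith

end ContinuedFraction

end MCircle

namespace MCircle

/-! ### Lifts ordered like an irrational rotation -/

/-- A continuous lift of a circle homeomorphism whose orbits are ordered as the orbits of the
rotation by the irrational number `ρ`. -/
structure IsRotationLike (f : ℝ → ℝ) (ρ : ℝ) : Prop where
  mono : StrictMono f
  cont : Continuous f
  periodic : ∀ x, f (x + 1) = f x + 1
  irrational : Irrational ρ
  lt_add : ∀ (k : ℕ) (l : ℤ), (k : ℝ) * ρ < l → ∀ x, f^[k] x < x + l
  add_lt : ∀ (k : ℕ) (l : ℤ), (l : ℝ) < k * ρ → ∀ x, x + l < f^[k] x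

lemma isRotationLike_of_hasRotNumber {f : ℝ → ℝ} {ρ : ℝ} (hf : IsCircleMapLift f)
    (hρ : HasRotNumber f ρ) (hirr : Irrational ρ) : IsRotationLike f ρ := by
  let F : CircleDeg1Lift := ⟨⟨f, hf.mono.monotone⟩, hf.periodic⟩
  have hF : ∀ k : ℕ, ((F ^ k : CircleDeg1Lift) : ℝ → ℝ) = f^[k] := fun k => F.coe_pow k
  have hτ : CircleDeg1Lift.translationNumber F = ρ := by
    apply CircleDeg1Lift.translationNumber_eq_of_tendsto₀
    exact hρ
  refine ⟨hf.mono, hf.smooth.continuous, hf.periodic, hirr, fun k l h x => ?_, fun k l h x => ?_⟩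
  · rw [← hF]
    apply CircleDeg1Lift.map_lt_of_translationNumber_lt_int
    rwa [CircleDeg1Lift.translationNumber_pow, hτ]
  · rw [← hF]
    apply CircleDeg1Lift.lt_map_of_int_lt_translationNumber
    rwa [CircleDeg1Lift.translationNumber_pow, hτ]

/-- The conjugate of `f` by the reflection `x ↦ -x`. -/
def reflect (f : ℝ → ℝ) (x : ℝ) : ℝ := -f (-x)

lemma reflect_iterate (f : ℝ → ℝ) (k : ℕ) (x : ℝ) : (reflect f)^[k] x = -f^[k] (-x) := by
  induction k with
  | zero => simp
  | succ k ih => rw [Function.iterate_succ_apply', Function.iterate_succ_apply', ih, reflect,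
      neg_neg]

/-- The `q`-th iterate of the lift `f`, corrected by the integer translation `p`. -/
def liftRet (f : ℝ → ℝ) (q : ℕ) (p : ℤ) (x : ℝ) : ℝ := f^[q] x - p

lemma liftRet_reflect (f : ℝ → ℝ) (q : ℕ) (p : ℤ) (x : ℝ) :
    liftRet (reflect f) q (-p) x = -liftRet f q p (-x) := by
  simp only [liftRet, reflect_iterate]; push_cast; ring

namespace IsRotationLike

variable {f : ℝ → ℝ} {ρ : ℝ} {q Q : ℕ} {p P : ℤ}

lemma reflect (h : IsRotationLike f ρ) : IsRotationLike (reflect f) (-ρ) where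
  mono x y hxy := by simpa [MCircle.reflect] using h.mono (neg_lt_neg hxy)
  cont := (h.cont.comp continuous_neg).neg
  periodic x := by
    have := h.periodic (-(x + 1))
    rw [show -(x + 1) + 1 = -x by ring] at this
    simp only [MCircle.reflect]
    linarith
  irrational := h.irrational.neg
  lt_add k l hkl x := by
    have := h.add_lt k (-l) (by push_cast; linarith) (-x)
    rw [reflect_iterate]; push_cast at this; linarith
  add_lt k l hkl x := by
    have := h.lt_add k (-l) (by push_cast; linarith) (-x)
    rw [reflect_iterate]; push_cast at this; linarith

lemma iterate_add_int (h : IsRotationLike f ρ) (k : ℕ) (x : ℝ) (l : ℤ) :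
    f^[k] (x + l) = f^[k] x + l := by
  let F : CircleDeg1Lift := ⟨⟨f, h.mono.monotone⟩, h.periodic⟩
  have := (F ^ k).map_add_int x l
  rwa [F.coe_pow] at this

lemma iterate_sub_int (h : IsRotationLike f ρ) (k : ℕ) (x : ℝ) (l : ℤ) :
    f^[k] (x - l) = f^[k] x - l := by
  have := h.iterate_add_int k x (-l)
  push_cast at this
  simpa [sub_eq_add_neg] using this

lemma iterate_strictMono (h : IsRotationLike f ρ) (k : ℕ) : StrictMono f^[k] := h.mono.iterate k

lemma liftRet_strictMono (h : IsRotationLike f ρ) (q : ℕ) (p : ℤ) :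
    StrictMono (liftRet f q p) := fun _ _ hxy =>
  sub_lt_sub_right (h.iterate_strictMono q hxy) _

lemma liftRet_continuous (h : IsRotationLike f ρ) (q : ℕ) (p : ℤ) :
    Continuous (liftRet f q p) := (h.cont.iterate q).sub continuous_const

lemma liftRet_add_int (h : IsRotationLike f ρ) (q : ℕ) (p : ℤ) (x : ℝ) (l : ℤ) :
    liftRet f q p (x + l) = liftRet f q p x + l := by
  simp only [liftRet, h.iterate_add_int]; ring

lemma iterate_liftRet (h : IsRotationLike f ρ) (k q : ℕ) (p : ℤ) (x : ℝ) :
    f^[k] (liftRet f q p x) = liftRet f q p (f^[k] x) := by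
  rw [liftRet, h.iterate_sub_int, liftRet, ← Function.iterate_add_apply,
    ← Function.iterate_add_apply, add_comm]

lemma liftRet_liftRet (h : IsRotationLike f ρ) (q q' : ℕ) (p p' : ℤ) (x : ℝ) :
    liftRet f q p (liftRet f q' p' x) = liftRet f (q + q') (p + p') x := by
  simp only [liftRet, h.iterate_sub_int, Function.iterate_add_apply]; push_cast; ring

lemma liftRet_lt_liftRet (h : IsRotationLike f ρ) {k k' : ℕ} {l l' : ℤ}
    (hlt : (k : ℝ) * ρ - l < k' * ρ - l') (x : ℝ) : liftRet f k l x < liftRet f k' l' x := by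
  simp only [liftRet]
  rcases le_total k k' with hk | hk
  · obtain ⟨m, rfl⟩ := Nat.exists_eq_add_of_le' hk
    have := h.add_lt m (l' - l) (by push_cast at hlt ⊢; linarith) (f^[k] x)
    rw [Function.iterate_add_apply]; push_cast at this; linarith
  · obtain ⟨m, rfl⟩ := Nat.exists_eq_add_of_le' hk
    have := h.lt_add m (l - l') (by push_cast at hlt ⊢; linarith) (f^[k'] x)
    rw [Function.iterate_add_apply]; push_cast at this; linarith

lemma liftRet_le_liftRet (h : IsRotationLike f ρ) {k k' : ℕ} {l l' : ℤ}
    (hle : (k : ℝ) * ρ - l ≤ k' * ρ - l') (x : ℝ) : liftRet f k l x ≤ liftRet f k' l' x := by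
  rcases hle.lt_or_eq with hlt | heq
  · exact (h.liftRet_lt_liftRet hlt x).le
  · have hk : k = k' := by
      by_contra hne
      have hne' : (k : ℤ) - k' ≠ 0 := by omega
      have := (h.irrational.intCast_mul hne').ne_int (l - l')
      apply this
      push_cast; linarith
    subst hk
    have : (l : ℝ) = l' := by linarith
    have : l = l' := by exact_mod_cast this
    rw [this]

lemma lt_liftRet (h : IsRotationLike f ρ) (hα : 0 < (q : ℝ) * ρ - p) (x : ℝ) :
    x < liftRet f q p x := by
  simpa [liftRet] using h.liftRet_lt_liftRet (k := 0) (l := 0) (by simpa using hα) x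

lemma liftRet_lt_add_one (h : IsRotationLike f ρ) (hα : (q : ℝ) * ρ - p < 1) (x : ℝ) :
    liftRet f q p x < x + 1 := by
  simpa [liftRet] using h.liftRet_lt_liftRet (k' := 0) (l' := -1) (by simpa using hα) x

lemma liftRet_surjective (h : IsRotationLike f ρ) (q : ℕ) (p : ℤ) :
    Function.Surjective (liftRet f q p) := by
  have hτ : ∃ m : ℤ, ∀ x, |liftRet f q p x - x| ≤ m := by
    obtain ⟨m, hm⟩ := exists_nat_gt |(q : ℝ) * ρ - p|
    refine ⟨m, fun x => ?_⟩
    rw [abs_lt] at hm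
    rw [abs_le]
    have h1 := h.liftRet_lt_liftRet (k := q) (l := p) (k' := 0) (l' := -m)
      (by push_cast; linarith) x
    have h2 := h.liftRet_lt_liftRet (k' := q) (l' := p) (k := 0) (l := m)
      (by push_cast; linarith) x
    simp only [liftRet, Function.iterate_zero, id] at h1 h2 ⊢
    push_cast at h1 h2 ⊢
    constructor <;> linarith
  obtain ⟨m, hm⟩ := hτ
  intro y
  have h1 := abs_le.1 (hm (y - m))
  have h2 := abs_le.1 (hm (y + m))
  have := intermediate_value_Icc (a := y - m) (b := y + m)
    (by linarith [(abs_nonneg _).trans (hm 0)]) (h.liftRet_continuous q p).continuousOn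
  obtain ⟨z, -, hz⟩ := this (show y ∈ Icc _ _ from ⟨by linarith, by linarith⟩)
  exact ⟨z, hz⟩

/-- The arcs `f^i [x, f^q x)`, for `i` in a block of `Q` consecutive times, are disjoint. -/
lemma disjoint_arcs (h : IsRotationLike f ρ) (r : IsReturnPair ρ q p Q P) (x t : ℝ) {i j : ℕ}
    (hij : i < j) (hji : j < i + Q) (l : ℤ)
    (hi : t ∈ Ico (f^[i] x) (f^[i] (liftRet f q p x)))
    (hj : t + l ∈ Ico (f^[j] x) (f^[j] (liftRet f q p x))) : False := by
  obtain ⟨m, rfl⟩ := Nat.exists_eq_add_of_le hij.le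
  rw [Nat.add_comm i m, Function.iterate_add_apply, Function.iterate_add_apply] at hj
  rw [h.iterate_liftRet] at hi hj
  rw [h.iterate_liftRet] at hj
  set y := f^[i] x
  have hb := r.best m (by omega) (by omega) l
  rcases le_abs.1 hb with hb | hb
  · have := h.liftRet_le_liftRet (k := q) (l := p) (k' := m) (l' := l) hb y
    have h1 : liftRet f m l y = f^[m] y - l := rfl
    linarith [hi.2, hj.1]
  · have := h.liftRet_le_liftRet (k := q + m) (l := p + l) (k' := 0) (l' := 0)
      (by push_cast; linarith) y
    rw [← h.liftRet_liftRet] at this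
    have h1 : liftRet f m l y = f^[m] y + (-l : ℤ) := by rw [liftRet]; push_cast; ring
    rw [h1, h.liftRet_add_int] at this
    have h2 : liftRet f 0 0 y = y := by simp [liftRet]
    rw [h2] at this
    push_cast at this
    linarith [hi.1, hj.2]

/-- Every arc `(t, f^q t]` is visited by each orbit before time `q + Q`. -/
lemma exists_visit (h : IsRotationLike f ρ) (r : IsReturnPair ρ q p Q P) (x t : ℝ) :
    ∃ i < q + Q, ∃ l : ℤ, liftRet f i l x ∈ Ioc t (liftRet f q p t) := by
  have hq := r.q_pos
  let g : ℕ → ℝ := fun i => liftRet f i ⌈f^[i] x - t⌉ x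
  have hg : ∀ i, g i ≤ t := fun i => by
    have := Int.le_ceil (f^[i] x - t)
    simp only [g, liftRet]; linarith
  have hgmax : ∀ i (l : ℤ), liftRet f i l x ≤ t → liftRet f i l x ≤ g i := fun i l hl => by
    simp only [g, liftRet] at hl ⊢
    have : ⌈f^[i] x - t⌉ ≤ l := Int.ceil_le.2 (by linarith)
    have : ((⌈f^[i] x - t⌉ : ℤ) : ℝ) ≤ l := by exact_mod_cast this
    linarith
  obtain ⟨i, hi, himax⟩ := Finset.exists_max_image (Finset.range (q + Q)) g
    ⟨0, Finset.mem_range.2 (by omega)⟩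
  rw [Finset.mem_range] at hi
  set l := ⌈f^[i] x - t⌉ with hl
  have hgi : g i = liftRet f i l x := rfl
  have hlow : ∀ i' < q + Q, ∀ l' : ℤ, g i < liftRet f i' l' x → t < liftRet f i' l' x := by
    intro i' hi' l' hlt
    by_contra hcon
    exact absurd ((hgmax i' l' (not_lt.1 hcon)).trans (himax i' (Finset.mem_range.2 hi')))
      (not_le.2 hlt)
  have hup : liftRet f (q + i) (p + l) x ≤ liftRet f q p t := by
    rw [← h.liftRet_liftRet]
    exact (h.liftRet_strictMono q p).monotone (hg i)
  by_cases hiQ : i < Q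
  · refine ⟨q + i, by omega, p + l, hlow _ (by omega) _ ?_, hup⟩
    rw [← h.liftRet_liftRet]
    exact h.lt_liftRet r.pos _
  · obtain ⟨m, rfl⟩ := Nat.exists_eq_add_of_le' (not_lt.1 hiQ)
    have h1 := r.next_neg
    have h2 := r.next_le
    refine ⟨m, by omega, l - P, hlow _ (by omega) _ ?_, le_trans ?_ hup⟩
    · rw [hgi]
      exact h.liftRet_lt_liftRet (by push_cast; linarith) x
    · exact h.liftRet_le_liftRet (by push_cast; linarith) x

lemma card_visits_le (h : IsRotationLike f ρ) (r : IsReturnPair ρ q p Q P) (x z : ℝ)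
    {m : ℕ} (hm : m ≤ 2 * Q) (s : Finset ℕ) (hs : s ⊆ Finset.range m)
    (hvis : ∀ j ∈ s, ∃ l : ℤ, z + l ∈ Ico (f^[j] x) (f^[j] (liftRet f q p x))) :
    s.card ≤ 2 := by
  have key : ∀ a, ∀ s' ⊆ s, (∀ j ∈ s', a ≤ j ∧ j < a + Q) → s'.card ≤ 1 := by
    intro a s' hs' hblock
    rw [Finset.card_le_one]
    have aux : ∀ i ∈ s', ∀ j ∈ s', i < j → False := by
      intro i hi j hj hij
      obtain ⟨l, hl⟩ := hvis i (hs' hi)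
      obtain ⟨l', hl'⟩ := hvis j (hs' hj)
      refine h.disjoint_arcs r x (z + l) hij ?_ (l' - l) hl ?_
      · have := hblock i hi; have := hblock j hj; omega
      · convert hl' using 1; push_cast; ring
    intro i hi j hj
    rcases lt_trichotomy i j with hij | hij | hij
    · exact (aux i hi j hj hij).elim
    · exact hij
    · exact (aux j hj i hi hij).elim
  have hunion : s = s.filter (· < Q) ∪ s.filter (¬ · < Q) :=
    (Finset.filter_union_filter_not_eq _ _).symm
  rw [hunion]
  refine (Finset.card_union_le _ _).trans ?_
  have h1 := key 0 (s.filter (· < Q)) (Finset.filter_subset _ _) (by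
    intro j hj; rw [Finset.mem_filter] at hj; omega)
  have h2 := key Q (s.filter (¬ · < Q)) (Finset.filter_subset _ _) (by
    intro j hj; rw [Finset.mem_filter] at hj
    have := Finset.mem_range.1 (hs hj.1); omega)
  omega

end IsRotationLike

/-- Arcs which are pairwise disjoint on the circle have total length at most one. -/
lemma sum_length_le_one {ι : Type*} (s : Finset ι) (a b : ι → ℝ) (hab : ∀ i ∈ s, a i ≤ b i)
    (hb : ∀ i ∈ s, b i ≤ a i + 1)
    (hdisj : ∀ i ∈ s, ∀ j ∈ s, i ≠ j → ∀ (t : ℝ) (l : ℤ),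
      t ∈ Ico (a i) (b i) → t + l ∈ Ico (a j) (b j) → False) :
    ∑ i ∈ s, (b i - a i) ≤ 1 := by
  classical
  have hself : ∀ i ∈ s, ∀ (t : ℝ) (l : ℤ), t ∈ Ico (a i) (b i) → t + l ∈ Ico (a i) (b i) →
      l = 0 := by
    intro i hi t l h1 h2
    have := hb i hi
    have h3 : (l : ℝ) < 1 := by linarith [h1.1, h2.2]
    have h4 : (-1 : ℝ) < l := by linarith [h1.2, h2.1]
    have h3' : l < 1 := by exact_mod_cast h3
    have h4' : -1 < l := by exact_mod_cast h4
    omega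
  let A : ι × ℤ → Set ℝ := fun v => Ico (a v.1 + v.2) (b v.1 + v.2) ∩ Ico 0 1
  have hmeas : ∀ v, MeasurableSet (A v) := fun v => measurableSet_Ico.inter measurableSet_Ico
  have hone : ∀ i ∈ s, ENNReal.ofReal (b i - a i) = ∑' l : ℤ, MeasureTheory.volume (A (i, l)) := by
    intro i hi
    rw [← Real.volume_Ico]
    have hcov : Ico (a i) (b i) = ⋃ l : ℤ, Ico (a i) (b i) ∩ Ico (-l : ℝ) (-l + 1) := by
      ext t
      simp only [mem_iUnion, mem_inter_iff, exists_and_left, iff_self_and]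
      intro _
      exact ⟨-⌊t⌋, by push_cast; rw [neg_neg]; exact ⟨Int.floor_le t, Int.lt_floor_add_one t⟩⟩
    conv_lhs => rw [hcov]
    rw [MeasureTheory.measure_iUnion]
    · refine tsum_congr fun l => ?_
      have := MeasureTheory.measure_preimage_add_right
        (MeasureTheory.volume : MeasureTheory.Measure ℝ)
        (l : ℝ) (A (i, l))
      rw [← this]
      congr 1
      ext t
      simp only [A, mem_inter_iff, mem_Ico, mem_preimage]
      constructor <;> rintro ⟨⟨_, _⟩, _, _⟩ <;> refine ⟨⟨?_, ?_⟩, ?_, ?_⟩ <;> linarith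
    · intro l l' hll'
      rw [Function.onFun, Set.disjoint_left]
      rintro t ⟨-, h1, h2⟩ ⟨-, h3, h4⟩
      apply hll'
      have h5 : (l : ℝ) < l' + 1 := by linarith
      have h6 : (l' : ℝ) < l + 1 := by linarith
      have h5' : l < l' + 1 := by exact_mod_cast h5
      have h6' : l' < l + 1 := by exact_mod_cast h6
      omega
    · exact fun l => measurableSet_Ico.inter measurableSet_Ico
  have htot : ENNReal.ofReal (∑ i ∈ s, (b i - a i)) ≤ 1 := by
    rw [ENNReal.ofReal_sum_of_nonneg (fun i hi => sub_nonneg.2 (hab i hi)),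
      Finset.sum_congr rfl hone]
    have : ∀ i, ∑' l : ℤ, MeasureTheory.volume (A (i, l)) =
        ∑' l : ℤ, (fun v : ι × ℤ => MeasureTheory.volume (A v)) (i, l) := fun _ => rfl
    rw [← Finset.tsum_subtype s fun i => ∑' l : ℤ, MeasureTheory.volume (A (i, l)),
      ← ENNReal.tsum_prod (f := fun (i : s) (l : ℤ) => MeasureTheory.volume (A (i.1, l)))]
    rw [← MeasureTheory.measure_iUnion (f := fun v : s × ℤ => A (v.1.1, v.2))]
    · calc _ ≤ MeasureTheory.volume (Ico (0 : ℝ) 1) :=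
            MeasureTheory.measure_mono (iUnion_subset fun v => inter_subset_right)
        _ = 1 := by simp
    · rintro ⟨⟨i, hi⟩, l⟩ ⟨⟨j, hj⟩, l'⟩ hne
      rw [Function.onFun, Set.disjoint_left]
      rintro t ⟨⟨h1, h2⟩, -⟩ ⟨⟨h3, h4⟩, -⟩
      simp only at h1 h2 h3 h4
      have m1 : t - l ∈ Ico (a i) (b i) := ⟨by linarith, by linarith⟩
      have m2 : t - l + (l - l' : ℤ) ∈ Ico (a j) (b j) := by
        push_cast; exact ⟨by linarith, by linarith⟩
      by_cases hij : i = j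
      · subst hij
        have := hself i hi _ _ m1 m2
        apply hne
        have : l = l' := by omega
        rw [this]
      · exact hdisj i hi j hj hij _ _ m1 m2
    · exact fun v => hmeas _
  have := (ENNReal.ofReal_le_iff_le_toReal ENNReal.one_ne_top).1 htot
  simpa using this

namespace IsRotationLike

variable {f : ℝ → ℝ} {ρ : ℝ} {q Q : ℕ} {p P : ℤ}

lemma sum_arcs_le (h : IsRotationLike f ρ) (r : IsReturnPair ρ q p Q P) (x : ℝ) {m : ℕ}
    (hm : m ≤ 2 * Q) :
    ∑ j ∈ Finset.range m, (f^[j] (liftRet f q p x) - f^[j] x) ≤ 2 := by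
  have hnn : ∀ j, f^[j] x ≤ f^[j] (liftRet f q p x) := fun j =>
    (h.iterate_strictMono j).monotone (h.lt_liftRet r.pos x).le
  have key : ∀ c, ∑ j ∈ Finset.range Q, (f^[c + j] (liftRet f q p x) - f^[c + j] x) ≤ 1 := by
    intro c
    refine sum_length_le_one _ (fun j => f^[c + j] x) (fun j => f^[c + j] (liftRet f q p x))
      (fun j _ => hnn _) (fun j _ => ?_) ?_
    · rw [h.iterate_liftRet]; exact (h.liftRet_lt_add_one r.lt_one _).le
    · intro i hi j hj hij t l h1 h2
      rw [Finset.mem_range] at hi hj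
      rcases lt_or_gt_of_ne hij with hij | hij
      · exact h.disjoint_arcs r x t (by omega) (by omega) l h1 h2
      · refine h.disjoint_arcs r x (t + l) (i := c + j) (j := c + i) (by omega) (by omega) (-l)
          h2 ?_
        convert h1 using 1; push_cast; ring
  calc _ ≤ ∑ j ∈ Finset.range (Q + Q), (f^[j] (liftRet f q p x) - f^[j] x) :=
        Finset.sum_le_sum_of_subset_of_nonneg (Finset.range_mono (by omega))
          (fun j _ _ => sub_nonneg.2 (hnn j))
    _ ≤ 2 := by
        rw [Finset.sum_range_add]
        have h1 := key 0
        simp only [zero_add] at h1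
        linarith [key Q]

end IsRotationLike

end MCircle

namespace MCircle

/-! ### Cross-ratio distortion and real bounds -/

lemma crossRatio_pos {a b c e : ℝ} (hab : a < b) (hbc : b < c) (hce : c < e) :
    0 < crossRatio a b c e :=
  div_pos (mul_pos (sub_pos.2 hab) (sub_pos.2 hce))
    (mul_pos (sub_pos.2 (hab.trans hbc)) (sub_pos.2 (hbc.trans hce)))

lemma crossRatio_neg (a b c e : ℝ) :
    crossRatio (-e) (-c) (-b) (-a) = crossRatio a b c e := by
  simp only [crossRatio]; congr 1 <;> ring

lemma crossRatio_sub (a b c e t : ℝ) :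
    crossRatio (a - t) (b - t) (c - t) (e - t) = crossRatio a b c e := by
  simp only [crossRatio]; congr 1 <;> ring

lemma le_mul_of_inv_le_crossRatio {a b c e D : ℝ} (hab : a < b) (hbc : b < c) (hce : c < e)
    (hD : 0 < D) (h : D⁻¹ ≤ crossRatio a b c e) :
    c - b ≤ D * (b - a) ∧ c - b ≤ D * (e - c) := by
  rw [crossRatio, le_div_iff₀ (by apply mul_pos <;> linarith), inv_mul_le_iff₀ hD] at h
  constructor
  · have : (c - a) * (e - c) ≤ D * (b - a) * (e - c) := by
      nlinarith [mul_pos (sub_pos.2 (hab.trans hbc)) (sub_pos.2 hbc)]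
    have := le_of_mul_le_mul_right this (sub_pos.2 hce)
    linarith
  · have : (e - b) * (b - a) ≤ D * (e - c) * (b - a) := by
      nlinarith [mul_pos (sub_pos.2 (hbc.trans hce)) (sub_pos.2 hbc)]
    have := le_of_mul_le_mul_right this (sub_pos.2 hab)
    linarith

lemma inv_le_crossRatio {a b c e A : ℝ} (hab : a < b) (hbc : b < c) (hce : c < e) (hA : 0 ≤ A)
    (hL : c - b ≤ A * (b - a)) (hR : c - b ≤ A * (e - c)) :
    ((1 + A) ^ 2)⁻¹ ≤ crossRatio a b c e := by
  rw [crossRatio, le_div_iff₀ (by apply mul_pos <;> linarith), inv_mul_le_iff₀ (by positivity)]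
  have h1 : c - a ≤ (1 + A) * (b - a) := by linarith
  have h2 : e - b ≤ (1 + A) * (e - c) := by linarith
  calc (c - a) * (e - b) ≤ ((1 + A) * (b - a)) * ((1 + A) * (e - c)) :=
        mul_le_mul h1 h2 (by linarith) (by nlinarith)
    _ = _ := by ring

/-- A bound for the distortion of cross-ratios under one application of `f`, where `Z` is a set
of representatives of the points of the circle near which the distortion may be large. -/
structure HasCrossRatioBound (f : ℝ → ℝ) (Z : Finset ℝ) (K C : ℝ) : Prop where
  one_le : 1 ≤ K
  nonneg : 0 ≤ C
  le : ∀ a b c e, a < b → b < c → c < e → e - a ≤ 3 →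
    crossRatio (f a) (f b) (f c) (f e) ≤ K * Real.exp (C * (e - a) ^ 2) * crossRatio a b c e
  le_of_disjoint : ∀ a b c e, a < b → b < c → c < e → e - a ≤ 3 →
    (¬ ∃ z ∈ Z, ∃ k : ℤ, z + k ∈ Ioo a e) →
    crossRatio (f a) (f b) (f c) (f e) ≤ Real.exp (C * (e - a) ^ 2) * crossRatio a b c e

lemma HasCrossRatioBound.reflect {f : ℝ → ℝ} {Z : Finset ℝ} {K C : ℝ}
    (hc : HasCrossRatioBound f Z K C) : HasCrossRatioBound (reflect f) (Z.image (- ·)) K C where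
  one_le := hc.one_le
  nonneg := hc.nonneg
  le a b c e hab hbc hce hea := by
    have := hc.le (-e) (-c) (-b) (-a) (neg_lt_neg hce) (neg_lt_neg hbc) (neg_lt_neg hab)
      (by linarith)
    rw [crossRatio_neg, ← crossRatio_neg (f (-e))] at this
    rwa [show -a - -e = e - a by ring] at this
  le_of_disjoint a b c e hab hbc hce hea hZ := by
    have := hc.le_of_disjoint (-e) (-c) (-b) (-a) (neg_lt_neg hce) (neg_lt_neg hbc)
      (neg_lt_neg hab) (by linarith) (by
        rintro ⟨z, hz, k, hk⟩
        refine hZ ⟨-z, Finset.mem_image_of_mem _ hz, -k, ?_⟩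
        push_cast
        exact ⟨by linarith [hk.2], by linarith [hk.1]⟩)
    rw [crossRatio_neg, ← crossRatio_neg (f (-e))] at this
    rwa [show -a - -e = e - a by ring] at this

/-- The bound for the distortion of cross-ratios along a chain of iterates. -/
def chainBound (Z : Finset ℝ) (K C η : ℝ) : ℝ := K ^ (6 * Z.card) * Real.exp (18 * C * η)

/-- The comparability constant resulting from a bound `B` for the distortion of cross-ratios. -/
def adjBound (B : ℝ) : ℝ := B * (1 + (4 * B + 1)) ^ 2

/-- The bound for scaling ratios resulting from a bound `B` for the distortion of cross-ratios
and a comparability constant `A`. -/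
def scalingBound (B A : ℝ) : ℝ := 4 * B * (A * (2 + A) * (1 + A))

namespace IsRotationLike

variable {f : ℝ → ℝ} {ρ K C η : ℝ} {q Q : ℕ} {p P : ℤ} {Z : Finset ℝ}

/-- The cross-ratio inequality. -/
lemma crossRatio_iterate_le (h : IsRotationLike f ρ) (hc : HasCrossRatioBound f Z K C)
    (r : IsReturnPair ρ q p Q P) (hη : ∀ y, liftRet f q p y - y ≤ η) {x a b c e : ℝ}
    (hxa : x ≤ a) (hab : a < b) (hbc : b < c) (hce : c < e)
    (he : e ≤ liftRet f q p (liftRet f q p (liftRet f q p x))) {m : ℕ} (hm : m ≤ 2 * Q) :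
    crossRatio (f^[m] a) (f^[m] b) (f^[m] c) (f^[m] e) ≤
      chainBound Z K C η * crossRatio a b c e := by
  classical
  set g := liftRet f q p with hg
  let crit : ℕ → Prop := fun j => ∃ z ∈ Z, ∃ k : ℤ, z + k ∈ Ioo (f^[j] a) (f^[j] e)
  have hK0 : 0 < K := one_pos.trans_le hc.one_le
  have hle : ∀ j, f^[j] x ≤ f^[j] a ∧ f^[j] e ≤ f^[j] (g (g (g x))) := fun j =>
    ⟨(h.iterate_strictMono j).monotone hxa, (h.iterate_strictMono j).monotone he⟩
  have hcomm : ∀ j, f^[j] (g x) = g (f^[j] x) ∧ f^[j] (g (g x)) = g (g (f^[j] x)) ∧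
      f^[j] (g (g (g x))) = g (g (g (f^[j] x))) := fun j => by
    simp only [hg, h.iterate_liftRet, and_self]
  have hlen : ∀ j, f^[j] e - f^[j] a ≤ 3 ∧ f^[j] e - f^[j] a ≤ 3 * η := fun j => by
    have h1 := hle j
    rw [(hcomm j).2.2] at h1
    set y := f^[j] x
    constructor
    · linarith [h.liftRet_lt_add_one r.lt_one y, h.liftRet_lt_add_one r.lt_one (g y),
        h.liftRet_lt_add_one r.lt_one (g (g y))]
    · linarith [hη y, hη (g y), hη (g (g y))]
  have hstep : ∀ m, crossRatio (f^[m] a) (f^[m] b) (f^[m] c) (f^[m] e) ≤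
      K ^ ((Finset.range m).filter crit).card *
        Real.exp (∑ j ∈ Finset.range m, C * (f^[j] e - f^[j] a) ^ 2) * crossRatio a b c e := by
    intro m
    induction m with
    | zero => simp
    | succ m ih =>
      have sm := h.iterate_strictMono m
      simp only [Function.iterate_succ_apply']
      rw [Finset.sum_range_succ, Real.exp_add, Finset.range_add_one, Finset.filter_insert]
      by_cases hcr : crit m
      · rw [if_pos hcr, Finset.card_insert_of_notMem (by simp), pow_succ]
        refine (hc.le _ _ _ _ (sm hab) (sm hbc) (sm hce) (hlen m).1).trans ?_
        refine (mul_le_mul_of_nonneg_left ih (by positivity)).trans (le_of_eq (by ring))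
      · rw [if_neg hcr]
        refine (hc.le_of_disjoint _ _ _ _ (sm hab) (sm hbc) (sm hce) (hlen m).1 hcr).trans ?_
        refine (mul_le_mul_of_nonneg_left ih (by positivity)).trans (le_of_eq (by ring))
  refine (hstep m).trans (mul_le_mul_of_nonneg_right ?_ (crossRatio_pos hab hbc hce).le)
  refine mul_le_mul (pow_le_pow_right₀ hc.one_le ?_) (Real.exp_le_exp.2 ?_) (by positivity)
    (by positivity)
  · let vis : ℝ → ℝ → Finset ℕ := fun y z => (Finset.range m).filter
      fun j => ∃ l : ℤ, z + l ∈ Ico (f^[j] y) (f^[j] (g y))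
    have hvis : ∀ y z, (vis y z).card ≤ 2 := fun y z =>
      h.card_visits_le r y z hm _ (Finset.filter_subset _ _)
        (fun j hj => (Finset.mem_filter.1 hj).2)
    have hsub : (Finset.range m).filter crit ⊆
        Z.biUnion fun z => vis x z ∪ vis (g x) z ∪ vis (g (g x)) z := by
      intro j hj
      obtain ⟨hjm, z, hz, k, hk⟩ := Finset.mem_filter.1 hj
      simp only [vis, Finset.mem_biUnion, Finset.mem_union, Finset.mem_filter, hjm, true_and]
      refine ⟨z, hz, ?_⟩
      have h1 := hle j
      rcases lt_or_ge (z + k) (f^[j] (g x)) with h2 | h2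
      · exact Or.inl (Or.inl ⟨k, by linarith [hk.1], h2⟩)
      rcases lt_or_ge (z + k) (f^[j] (g (g x))) with h3 | h3
      · exact Or.inl (Or.inr ⟨k, h2, h3⟩)
      · exact Or.inr ⟨k, h3, by linarith [hk.2]⟩
    refine (Finset.card_le_card hsub).trans
      ((Finset.card_biUnion_le_card_mul _ _ 6 fun z _ => ?_).trans (le_of_eq (mul_comm _ _)))
    refine (Finset.card_union_le _ _).trans ?_
    have := Finset.card_union_le (vis x z) (vis (g x) z)
    have := hvis x z
    have := hvis (g x) z
    have := hvis (g (g x)) z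
    omega
  · have hsum : ∑ j ∈ Finset.range m, (f^[j] e - f^[j] a) ≤ 6 := by
      have h1 := h.sum_arcs_le r x hm
      have h2 := h.sum_arcs_le r (g x) hm
      have h3 := h.sum_arcs_le r (g (g x)) hm
      have h4 : ∑ j ∈ Finset.range m, (f^[j] e - f^[j] a) ≤
          ∑ j ∈ Finset.range m, ((f^[j] (g x) - f^[j] x) + (f^[j] (g (g x)) - f^[j] (g x)) +
            (f^[j] (g (g (g x))) - f^[j] (g (g x)))) :=
        Finset.sum_le_sum fun j _ => by linarith [(hle j).1, (hle j).2]
      rw [Finset.sum_add_distrib, Finset.sum_add_distrib] at h4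
      linarith
    have hη0 : 0 ≤ η := le_trans (sub_nonneg.2 (h.lt_liftRet r.pos 0).le) (hη 0)
    calc ∑ j ∈ Finset.range m, C * (f^[j] e - f^[j] a) ^ 2
        ≤ ∑ j ∈ Finset.range m, C * (3 * η) * (f^[j] e - f^[j] a) := by
          refine Finset.sum_le_sum fun j _ => ?_
          have := (hlen j).2
          have h0 : 0 < f^[j] e - f^[j] a :=
            sub_pos.2 (h.iterate_strictMono j (hab.trans (hbc.trans hce)))
          rw [sq, mul_assoc C]
          exact mul_le_mul_of_nonneg_left (mul_le_mul_of_nonneg_right this h0.le) hc.nonneg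
      _ = C * (3 * η) * ∑ j ∈ Finset.range m, (f^[j] e - f^[j] a) := by rw [Finset.mul_sum]
      _ ≤ C * (3 * η) * 6 := mul_le_mul_of_nonneg_left hsum (mul_nonneg hc.nonneg (by linarith))
      _ = 18 * C * η := by ring

lemma one_le_chainBound (hK : 1 ≤ K) (hC : 0 ≤ C) (hη : 0 ≤ η) : 1 ≤ chainBound Z K C η :=
  one_le_mul_of_one_le_of_one_le (one_le_pow₀ hK) (Real.one_le_exp (by positivity))

lemma exists_forall_displacement_ge (h : IsRotationLike f ρ) (q : ℕ) (p : ℤ) :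
    ∃ x₀, ∀ x, liftRet f q p x₀ - x₀ ≤ liftRet f q p x - x := by
  obtain ⟨x₀, -, hx₀⟩ := isCompact_Icc.exists_isMinOn (nonempty_Icc.2 (zero_le_one' ℝ))
    ((h.liftRet_continuous q p).sub continuous_id).continuousOn
  refine ⟨x₀, fun x => ?_⟩
  have h1 := hx₀ (show Int.fract x ∈ Icc (0 : ℝ) 1 from
    ⟨Int.fract_nonneg x, (Int.fract_lt_one x).le⟩)
  have h2 := h.liftRet_add_int q p (Int.fract x) ⌊x⌋
  rw [Int.fract_add_floor] at h2
  simp only [mem_ofPred_eq, Pi.sub_apply, id] at h1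
  linarith [Int.fract_add_floor x]

/-- Consecutive arcs of a closest return are comparable. -/
lemma adjacent_comparable (h : IsRotationLike f ρ) (hc : HasCrossRatioBound f Z K C)
    (r : IsReturnPair ρ q p Q P) (hη : ∀ y, liftRet f q p y - y ≤ η) (x : ℝ) :
    liftRet f q p x - x ≤ adjBound (chainBound Z K C η) *
        (liftRet f q p (liftRet f q p x) - liftRet f q p x) ∧
      liftRet f q p (liftRet f q p x) - liftRet f q p x ≤ adjBound (chainBound Z K C η) *
        (liftRet f q p x - x) := by
  set g := liftRet f q p with hg
  have hη0 : 0 ≤ η := le_trans (sub_nonneg.2 (h.lt_liftRet r.pos 0).le) (hη 0)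
  have hB1 : 1 ≤ chainBound Z K C η := one_le_chainBound hc.one_le hc.nonneg hη0
  have hB : ∀ {x a b c e : ℝ}, x ≤ a → a < b → b < c → c < e → e ≤ g (g (g x)) →
      ∀ {m : ℕ}, m ≤ 2 * Q → crossRatio (f^[m] a) (f^[m] b) (f^[m] c) (f^[m] e) ≤
        chainBound Z K C η * crossRatio a b c e := fun h1 h2 h3 h4 h5 _ h6 =>
    h.crossRatio_iterate_le hc r hη h1 h2 h3 h4 h5 h6
  generalize chainBound Z K C η = B at hB hB1 ⊢
  have hB0 : 0 < B := by linarith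
  have hlt : ∀ y, y < g y := h.lt_liftRet r.pos
  have hmono : StrictMono g := h.liftRet_strictMono q p
  obtain ⟨x₀, hmin⟩ := h.exists_forall_displacement_ge q p
  obtain ⟨w, hw⟩ := h.liftRet_surjective q p x₀
  obtain ⟨w', hw'⟩ := h.liftRet_surjective q p w
  rw [← hg] at hw hw' hmin
  have hpull : ∀ {a b c e D A : ℝ},
      A ≤ B * crossRatio a b c e → D⁻¹ ≤ A → (B * D)⁻¹ ≤ crossRatio a b c e := by
    intro a b c e D A h1 h2
    rw [mul_inv, inv_mul_le_iff₀ hB0]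
    exact h2.trans h1
  have hwx : x₀ - w ≤ 4 * B * (g x₀ - x₀) := by
    have h1 := hB (x := w') le_rfl (a := w') (b := w) (c := x₀) (e := g x₀)
      (hw' ▸ hlt w') (hw ▸ hlt w) (hlt x₀) (by rw [hw', hw]) (m := q)
      (by linarith [r.q_le])
    rw [← crossRatio_sub _ _ _ _ p] at h1
    have h2 : ∀ y, f^[q] y - p = g y := fun y => rfl
    rw [h2, h2, h2, h2, hw', hw] at h1
    have h3 := inv_le_crossRatio (a := w) (b := x₀) (c := g x₀) (e := g (g x₀)) (A := 1)
      (hw ▸ hlt w) (hlt x₀) (hlt _) zero_le_one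
      (by have := hmin w; rw [hw] at this; linarith) (by linarith [hmin (g x₀)])
    have h4 := hpull h1 h3
    have h5 := (le_mul_of_inv_le_crossRatio (hw' ▸ hlt w') (hw ▸ hlt w) (hlt x₀)
      (by positivity) h4).2
    linarith
  have main : ∀ x', g (g x') - g x' ≤ adjBound B * (g x' - x') ∧
      g (g x') - g x' ≤ adjBound B * (g (g (g x')) - g (g x')) := by
    intro x'
    obtain ⟨i, hi, l, hl1, hl2⟩ := h.exists_visit r (g x') w
    rw [← hg, hw] at hl2
    have h1 := hB (x := x') le_rfl (hlt x') (hlt (g x')) (hlt (g (g x'))) le_rfl (m := i)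
      (by have := r.q_le; omega)
    rw [← crossRatio_sub _ _ _ _ l] at h1
    have h2 : ∀ y, f^[i] (g y) - l = g (f^[i] y - l) := fun y => by
      have := h.liftRet_add_int q p (f^[i] y) (-l)
      push_cast at this
      rw [← sub_eq_add_neg, ← sub_eq_add_neg] at this
      rw [hg, h.iterate_liftRet, this]
    have h3 : liftRet f i l (g x') = g (f^[i] x' - l) := h2 x'
    simp only [h2] at h1
    rw [h3] at hl1 hl2
    set y := f^[i] x' - l
    have h4 : g (g y) ≤ g x₀ := hmono.monotone hl2
    have h5 : g (g y) - g y ≤ (4 * B + 1) * (g x₀ - x₀) := by linarith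
    have h6 := inv_le_crossRatio (A := 4 * B + 1) (hlt y) (hlt (g y)) (hlt (g (g y)))
      (by positivity)
      (h5.trans (mul_le_mul_of_nonneg_left (hmin y) (by positivity)))
      (h5.trans (mul_le_mul_of_nonneg_left (hmin (g (g y))) (by positivity)))
    have h7 := hpull h1 h6
    exact le_mul_of_inv_le_crossRatio (hlt x') (hlt (g x')) (hlt (g (g x')))
      (mul_pos hB0 (by positivity)) h7
  refine ⟨?_, (main x).1⟩
  obtain ⟨x', rfl⟩ := h.liftRet_surjective q p x
  exact (main x').2

/-- If consecutive arcs of a sequence of closest returns are comparable, then these returns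
converge uniformly to the identity. -/
lemma displacement_small (h : IsRotationLike f ρ) (q : ℕ → ℕ) (p : ℕ → ℤ)
    (hpos : ∀ n, 0 < (q n : ℝ) * ρ - p n) (hanti : Antitone fun n => (q n : ℝ) * ρ - p n)
    (hlim : Tendsto (fun n => (q n : ℝ) * ρ - p n) atTop (𝓝 0)) {B : ℝ} (hB : 0 < B)
    (hadj : ∀ n x, liftRet f (q n) (p n) x - x ≤
      B * (liftRet f (q n) (p n) (liftRet f (q n) (p n) x) - liftRet f (q n) (p n) x))
    (hη : 0 < η) : ∃ n₀, ∀ n ≥ n₀, ∀ x, liftRet f (q n) (p n) x - x ≤ η := by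
  set g : ℕ → ℝ → ℝ := fun n => liftRet f (q n) (p n) with hg
  have hlt : ∀ n x, x < g n x := fun n => h.lt_liftRet (hpos n)
  have hganti : ∀ x, Antitone fun n => g n x := fun x m n hmn =>
    h.liftRet_le_liftRet (hanti hmn) x
  have hpt : ∀ x, Tendsto (fun n => g n x) atTop (𝓝 x) := by
    intro x
    have hbdd : BddBelow (range fun n => g n x) := ⟨x, by rintro _ ⟨n, rfl⟩; exact (hlt n x).le⟩
    have hconv := tendsto_atTop_ciInf (hganti x) hbdd
    set y := ⨅ n, g n x with hy
    have hyle : ∀ n, y ≤ g n x := fun n => ciInf_le hbdd n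
    have hxy : x ≤ y := le_ciInf fun n => (hlt n x).le
    have hyx : y ≤ x := by
      refine le_of_forall_pos_le_add fun ε hε => ?_
      obtain ⟨l, hl⟩ := exists_lt_of_ciInf_lt
        (show ⨅ n, g n x < y + ε / B by rw [← hy]; linarith [div_pos hε hB])
      obtain ⟨m, hm⟩ := (hlim.eventually (gt_mem_nhds (half_pos (hpos l)))).exists
      have h1 : g m (g m x) < g l x := by
        simp only [hg, h.liftRet_liftRet]
        apply h.liftRet_lt_liftRet
        push_cast
        linarith
      have h2 : g m y ≤ g m (g m x) := (h.liftRet_strictMono _ _).monotone (hyle m)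
      obtain ⟨z, hz⟩ := h.liftRet_surjective (q m) (p m) y
      have hzx : z ≤ x := (h.liftRet_strictMono (q m) (p m)).le_iff_le.1 (hz ▸ hyle m)
      have h3 := hadj m z
      rw [hz] at h3
      have h4 : g m y - y ≤ ε / B := by linarith
      have h5 : B * (g m y - y) ≤ ε := by
        rw [le_div_iff₀ hB] at h4; linarith
      simp only [hg] at h5
      linarith
    rwa [le_antisymm hyx hxy] at hconv
  have hunif : TendstoUniformlyOn (fun n x => g n x - x) (fun _ => 0) atTop (Icc (0 : ℝ) 1) := by
    refine Antitone.tendstoUniformlyOn_of_forall_tendsto isCompact_Icc (fun n => ?_) ?_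
      continuousOn_const ?_
    · exact ((h.liftRet_continuous _ _).sub continuous_id).continuousOn
    · exact fun x _ m n hmn => sub_le_sub_right (hganti x hmn) x
    · intro x _
      simpa using (hpt x).sub_const x
  rw [Metric.tendstoUniformlyOn_iff] at hunif
  obtain ⟨n₀, hn₀⟩ := eventually_atTop.1 (hunif η hη)
  refine ⟨n₀, fun n hn x => ?_⟩
  have h1 := hn₀ n hn (Int.fract x) ⟨Int.fract_nonneg x, (Int.fract_lt_one x).le⟩
  rw [dist_comm, Real.dist_eq, sub_zero] at h1
  have h2 := h.liftRet_add_int (q n) (p n) (Int.fract x) ⌊x⌋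
  rw [Int.fract_add_floor] at h2
  have := (le_abs_self _).trans h1.le
  simp only [hg] at this
  linarith [Int.fract_add_floor x]

/-- At a critical point, the arcs of two successive closest returns are comparable. -/
lemma scaling_of_flat (h : IsRotationLike f ρ) (hc : HasCrossRatioBound f Z K C)
    (r : IsReturnPair ρ q p Q P) (hη : ∀ y, liftRet f q p y - y ≤ η) {B A c : ℝ}
    (hB : chainBound Z K C η ≤ B) (hA : 1 ≤ A)
    (hg1 : ∀ x, liftRet f q p x - x ≤
      A * (liftRet f q p (liftRet f q p x) - liftRet f q p x))
    (hv1 : ∀ x, x - liftRet f Q P x ≤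
      A * (liftRet f Q P x - liftRet f Q P (liftRet f Q P x)))
    (hv2 : ∀ x, liftRet f Q P x - liftRet f Q P (liftRet f Q P x) ≤
      A * (x - liftRet f Q P x))
    (hflat : ∀ x y, |x - c| ≤ η → |y - c| ≤ η → 2 * |x - c| ≤ |y - c| →
      |f x - f c| * |y - c| ^ 2 ≤ 4 * |x - c| ^ 2 * |f y - f c|) :
    c - liftRet f Q P c ≤ A * (liftRet f q p c - c) ∧
      liftRet f q p c - c ≤ scalingBound B A * (c - liftRet f Q P c) := by
  have hη0 : 0 ≤ η := le_trans (sub_nonneg.2 (h.lt_liftRet r.pos 0).le) (hη 0)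
  have hB1 : 1 ≤ B := (one_le_chainBound hc.one_le hc.nonneg hη0).trans hB
  set g := liftRet f q p with hg
  set v := liftRet f Q P with hv
  have hlt : ∀ y, y < g y := h.lt_liftRet r.pos
  have hvlt : ∀ y, v y < y := fun y => by
    have := h.liftRet_lt_liftRet (k := Q) (l := P) (k' := 0) (l' := 0)
      (by simpa using r.next_neg) y
    simpa [hv, liftRet] using this
  have gmono : StrictMono g := h.liftRet_strictMono q p
  have vmono : StrictMono v := h.liftRet_strictMono Q P
  have hgv : ∀ y, g (v y) = v (g y) := fun y => by
    simp only [hg, hv, h.liftRet_liftRet, add_comm]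
  have hcgv : c ≤ g (v c) := by
    have := h.liftRet_le_liftRet (k := 0) (l := 0) (k' := q + Q) (l' := p + P)
      (by push_cast; linarith [r.next_le]) c
    rw [← h.liftRet_liftRet] at this
    simpa [hg, hv, liftRet] using this
  obtain ⟨z, hz⟩ := h.liftRet_surjective q p c
  rw [← hg] at hz
  have hzv : z ≤ v c := gmono.le_iff_le.1 (by rw [hz]; exact hcgv)
  have hup : c - v c ≤ A * (g c - c) := by
    have := hg1 z
    rw [hz] at this
    linarith
  refine ⟨hup, ?_⟩
  set L := c - v c with hL
  set I := g c - c with hI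
  have hLpos : 0 < L := sub_pos.2 (hvlt c)
  have hIpos : 0 < I := sub_pos.2 (hlt c)
  have hD : 2 ≤ scalingBound B A := by
    have : 1 ≤ A * (2 + A) * (1 + A) := by
      apply one_le_mul_of_one_le_of_one_le (one_le_mul_of_one_le_of_one_le hA _) <;> linarith
    have : 1 ≤ B * (A * (2 + A) * (1 + A)) := one_le_mul_of_one_le_of_one_le hB1 this
    simp only [scalingBound]
    linarith
  rcases lt_or_ge I (2 * L) with hIL | hIL
  · exact hIL.le.trans (mul_le_mul_of_nonneg_right hD hLpos.le)
  have habsL : |v c - c| = L := by rw [abs_sub_comm, abs_of_pos hLpos]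
  have habsI : |g c - c| = I := abs_of_pos hIpos
  have hIη : I ≤ η := hη c
  have hfl := hflat (v c) (g c) (by rw [habsL]; linarith) (by rw [habsI]; exact hIη)
    (by rw [habsL, habsI]; exact hIL)
  rw [habsL, habsI, abs_sub_comm, abs_of_pos (sub_pos.2 (h.mono (hvlt c))),
    abs_of_pos (sub_pos.2 (h.mono (hlt c)))] at hfl
  have hQ : 0 < Q := r.q_pos.trans_le r.q_le
  have hgf : ∀ y, g (f y) = f (g y) := fun y => (h.iterate_liftRet 1 q p y).symm
  have h1 := h.crossRatio_iterate_le hc r hη (x := f z) (a := f (v c)) (b := f c)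
    (c := f (g c)) (e := f (g (g c)))
    (h.mono.monotone hzv) (h.mono (hvlt c)) (h.mono (hlt c)) (h.mono (hlt _))
    (by rw [← hg, hgf, hgf, hgf, hz]) (m := Q - 1) (by omega)
  rw [← crossRatio_sub _ _ _ _ P] at h1
  have h2 : ∀ y, f^[Q - 1] (f y) - P = v y := fun y => by
    rw [← Function.iterate_succ_apply, Nat.succ_eq_add_one, Nat.sub_add_cancel hQ]; rfl
  rw [h2, h2, h2, h2] at h1
  have hstart : crossRatio (f (v c)) (f c) (f (g c)) (f (g (g c))) ≤ 4 * L ^ 2 / I ^ 2 := by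
    have e1 := sub_pos.2 (h.mono (hvlt c))
    have e2 := sub_pos.2 (h.mono (hlt c))
    have e3 := sub_pos.2 (h.mono (hlt (g c)))
    rw [crossRatio, div_le_div_iff₀ (by apply mul_pos <;> linarith) (by positivity)]
    have e4 : 0 < L ^ 2 := by positivity
    calc (f c - f (v c)) * (f (g (g c)) - f (g c)) * I ^ 2
        = ((f c - f (v c)) * I ^ 2) * (f (g (g c)) - f (g c)) := by ring
      _ ≤ (4 * L ^ 2 * (f (g c) - f c)) * (f (g (g c)) - f (g c)) :=
          mul_le_mul_of_nonneg_right hfl e3.le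
      _ = 4 * L ^ 2 * ((f (g c) - f c) * (f (g (g c)) - f (g c))) := by ring
      _ ≤ 4 * L ^ 2 * ((f (g c) - f (v c)) * (f (g (g c)) - f c)) := by
          refine mul_le_mul_of_nonneg_left ?_ (by positivity)
          exact mul_le_mul (by linarith) (by linarith) e3.le (by linarith)
  have hend : L / (A * (2 + A) * (1 + A) * I) ≤
      crossRatio (v (v c)) (v c) (v (g c)) (v (g (g c))) := by
    have k1 : L ≤ A * (v c - v (v c)) := hv1 c
    have k2 : v c - v (v c) ≤ A * L := hv2 c
    have k3 : v (g c) - v c ≤ A * (v (g (g c)) - v (g c)) := by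
      have := hg1 (v c)
      rwa [hgv, hgv] at this
    have k4 : v (g c) < g c := hvlt _
    have e1 : 0 < v c - v (v c) := sub_pos.2 (hvlt (v c))
    have e2 : 0 < v (g c) - v c := sub_pos.2 (vmono (hlt c))
    have e3 : 0 < v (g (g c)) - v (g c) := sub_pos.2 (vmono (hlt (g c)))
    rw [crossRatio, div_le_div_iff₀ (by positivity) (by apply mul_pos <;> linarith)]
    have k5 : v (g c) - v (v c) ≤ (2 + A) * I := by nlinarith
    have k6 : v (g (g c)) - v c ≤ (1 + A) * (v (g (g c)) - v (g c)) := by linarith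
    calc L * ((v (g c) - v (v c)) * (v (g (g c)) - v c))
        ≤ (A * (v c - v (v c))) * (((2 + A) * I) * ((1 + A) * (v (g (g c)) - v (g c)))) := by
          refine mul_le_mul k1 (mul_le_mul k5 k6 (by linarith) (by positivity)) ?_ (by positivity)
          exact mul_nonneg (by linarith) (by linarith)
      _ = _ := by ring
  have hfin : L / (A * (2 + A) * (1 + A) * I) ≤ B * (4 * L ^ 2 / I ^ 2) := by
    refine hend.trans (h1.trans ?_)
    refine (mul_le_mul_of_nonneg_right hB ?_).trans
      (mul_le_mul_of_nonneg_left hstart (by linarith))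
    exact (crossRatio_pos (h.mono (hvlt c)) (h.mono (hlt c)) (h.mono (hlt _))).le
  rw [div_le_iff₀ (by positivity)] at hfin
  have e : B * (4 * L ^ 2 / I ^ 2) * (A * (2 + A) * (1 + A) * I) =
      (scalingBound B A * L / I) * L := by
    rw [scalingBound]; field_simp
  rw [e] at hfin
  have := (le_mul_iff_one_le_left hLpos).1 hfin
  rw [le_div_iff₀ hIpos] at this
  linarith

end IsRotationLike

end MCircle

namespace MCircle

/-! ### Power maps -/

lemma exists_uniform_of_local (P : ℝ → ℝ → ℝ → Prop)
    (hmono : ∀ {C C' a e}, C ≤ C' → P C a e → P C' a e)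
    (hper : ∀ {C a e} (k : ℤ), P C a e → P C (a + k) (e + k))
    (hloc : ∀ y ∈ Ico (0 : ℝ) 1, ∃ r > 0, ∃ C, ∀ a e, y - r < a → a < e → e < y + r → P C a e) :
    ∃ δ > 0, ∃ C, ∀ a e, a < e → e - a ≤ δ → P C a e := by
  have hloc' : ∀ y, ∃ r > 0, ∃ C, ∀ a e, y - r < a → a < e → e < y + r → P C a e := by
    intro y
    obtain ⟨r, hr, C, hC⟩ := hloc (Int.fract y) ⟨Int.fract_nonneg y, Int.fract_lt_one y⟩
    refine ⟨r, hr, C, fun a e ha hae he => ?_⟩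
    have hy := Int.fract_add_floor y
    have := hper ⌊y⌋ (hC (a - ⌊y⌋) (e - ⌊y⌋) (by linarith) (by linarith) (by linarith))
    simpa using this
  have key : ∃ δ > 0, ∃ C, ∀ a ∈ Icc (0 : ℝ) 1, ∀ e, a < e → e - a ≤ δ → P C a e := by
    refine isCompact_Icc.induction_on
      (p := fun s => ∃ δ > 0, ∃ C, ∀ a ∈ s, ∀ e, a < e → e - a ≤ δ → P C a e) ?_ ?_ ?_ ?_
    · exact ⟨1, one_pos, 0, fun a ha => absurd ha (notMem_empty a)⟩
    · rintro s t hst ⟨δ, hδ, C, h⟩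
      exact ⟨δ, hδ, C, fun a ha => h a (hst ha)⟩
    · rintro s t ⟨δ, hδ, C, h⟩ ⟨δ', hδ', C', h'⟩
      refine ⟨min δ δ', lt_min hδ hδ', max C C', ?_⟩
      rintro a (ha | ha) e hae he
      · exact hmono (le_max_left _ _) (h a ha e hae (he.trans (min_le_left _ _)))
      · exact hmono (le_max_right _ _) (h' a ha e hae (he.trans (min_le_right _ _)))
    · intro y _
      obtain ⟨r, hr, C, hC⟩ := hloc' y
      refine ⟨Ioo (y - r / 2) (y + r / 2), mem_nhdsWithin_of_mem_nhds
        (Ioo_mem_nhds (by linarith) (by linarith)), r / 2, half_pos hr, C, ?_⟩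
      exact fun a ha e hae he => hC a e (by linarith [ha.1]) hae (by linarith [ha.2])
  obtain ⟨δ, hδ, C, h⟩ := key
  refine ⟨δ, hδ, C, fun a e hae he => ?_⟩
  have ha := Int.fract_add_floor a
  have := hper ⌊a⌋ (h (Int.fract a) ⟨Int.fract_nonneg a, (Int.fract_lt_one a).le⟩ (e - ⌊a⌋)
    (by linarith) (by linarith))
  simpa using this

lemma crossRatio_le_of_slope_le {g : ℝ → ℝ} {a b c e M : ℝ} (hg : StrictMonoOn g (Icc a e))
    (hab : a < b) (hbc : b < c) (hce : c < e)
    (h1 : (g b - g a) * (c - a) ≤ M * (g c - g a) * (b - a))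
    (h2 : (g e - g c) * (e - b) ≤ M * (g e - g b) * (e - c)) :
    crossRatio (g a) (g b) (g c) (g e) ≤ M ^ 2 * crossRatio a b c e := by
  have ma : a ∈ Icc a e := ⟨le_rfl, by linarith⟩
  have mb : b ∈ Icc a e := ⟨hab.le, by linarith⟩
  have mc : c ∈ Icc a e := ⟨by linarith, hce.le⟩
  have me : e ∈ Icc a e := ⟨by linarith, le_rfl⟩
  have k1 := hg ma mb hab
  have k2 := hg mb mc hbc
  have k3 := hg mc me hce
  rw [crossRatio, crossRatio, ← mul_div_assoc,
    div_le_div_iff₀ (by apply mul_pos <;> linarith) (by apply mul_pos <;> linarith)]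
  calc (g b - g a) * (g e - g c) * ((c - a) * (e - b))
      = ((g b - g a) * (c - a)) * ((g e - g c) * (e - b)) := by ring
    _ ≤ (M * (g c - g a) * (b - a)) * (M * (g e - g b) * (e - c)) := by
        refine mul_le_mul h1 h2 (by apply mul_nonneg <;> linarith) (le_trans ?_ h1)
        apply mul_nonneg <;> linarith
    _ = _ := by ring

/-- The interval map `x ↦ x |x|^(δ-1)`. -/
def powerMap (δ x : ℝ) : ℝ := x * |x| ^ (δ - 1)

lemma powerMap_neg (δ x : ℝ) : powerMap δ (-x) = -powerMap δ x := by
  simp [powerMap]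

lemma powerMap_of_nonneg {δ x : ℝ} (hδ : 1 < δ) (hx : 0 ≤ x) : powerMap δ x = x ^ δ := by
  rw [powerMap, abs_of_nonneg hx]
  rcases hx.eq_or_lt with rfl | hx
  · rw [zero_mul, Real.zero_rpow (by linarith)]
  · rw [Real.rpow_sub_one hx.ne', mul_div_cancel₀ _ hx.ne']

lemma abs_powerMap {δ : ℝ} (hδ : 1 < δ) (x : ℝ) : |powerMap δ x| = |x| ^ δ := by
  rw [← powerMap_of_nonneg hδ (abs_nonneg x), powerMap, powerMap, abs_mul, abs_abs,
    abs_of_nonneg (Real.rpow_nonneg (abs_nonneg x) _)]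

lemma powerMap_sub_le {δ : ℝ} (hδ : 1 < δ) {s t W : ℝ} (hst : s < t) (hs : |s| ^ (δ - 1) ≤ W)
    (ht : |t| ^ (δ - 1) ≤ W) : powerMap δ t - powerMap δ s ≤ δ * W * (t - s) := by
  have key : ∀ {s t : ℝ}, 0 ≤ s → s < t → |t| ^ (δ - 1) ≤ W →
      powerMap δ t - powerMap δ s ≤ δ * W * (t - s) := by
    intro s t hs hst ht
    have ht0 : 0 < t := hs.trans_lt hst
    have h1 := one_add_mul_self_le_rpow_one_add (s := s / t - 1)
      (by linarith [div_nonneg hs ht0.le]) hδ.le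
    rw [add_sub_cancel, Real.div_rpow hs ht0.le, le_div_iff₀ (by positivity)] at h1
    rw [powerMap_of_nonneg hδ hs, powerMap_of_nonneg hδ ht0.le]
    rw [abs_of_pos ht0] at ht
    have h2 : t ^ δ = t ^ (δ - 1) * t := by
      rw [Real.rpow_sub_one ht0.ne', div_mul_cancel₀ _ ht0.ne']
    have h3 : δ * t ^ (δ - 1) * (t - s) ≤ δ * W * (t - s) := by
      gcongr
    refine le_trans ?_ h3
    have h4 : (1 + δ * (s / t - 1)) * t ^ δ = t ^ δ - δ * t ^ (δ - 1) * (t - s) := by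
      rw [h2]; field_simp; ring
    linarith
  rcases le_or_gt 0 s with h0 | h0
  · exact key h0 hst ht
  rcases le_or_gt t 0 with h1 | h1
  · have := key (s := -t) (t := -s) (by linarith) (by linarith) (by rwa [abs_neg])
    rw [powerMap_neg, powerMap_neg] at this
    linarith
  · have hW : 0 ≤ W := (Real.rpow_nonneg (abs_nonneg _) _).trans hs
    have k1 : powerMap δ t ≤ t * W := mul_le_mul_of_nonneg_left ht h1.le
    have k2 : s * W ≤ powerMap δ s := mul_le_mul_of_nonpos_left hs h0.le
    nlinarith [mul_nonneg hW (sub_pos.2 hst).le]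

lemma le_powerMap_sub {δ : ℝ} (hδ : 1 < δ) {s t : ℝ} (hst : s < t) :
    max (|s| ^ (δ - 1)) (|t| ^ (δ - 1)) * (t - s) ≤ 2 * (powerMap δ t - powerMap δ s) := by
  have key : ∀ {s t : ℝ}, s < t → |s| ≤ |t| →
      |t| ^ (δ - 1) * (t - s) ≤ 2 * (powerMap δ t - powerMap δ s) := by
    intro s t hst hle
    have ht : 0 < t := by
      by_contra! ht
      rw [abs_of_nonpos ht, abs_of_neg (by linarith)] at hle
      linarith
    have hw : |s| ^ (δ - 1) ≤ |t| ^ (δ - 1) :=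
      Real.rpow_le_rpow (abs_nonneg _) hle (by linarith)
    have hw0 : 0 ≤ |s| ^ (δ - 1) := Real.rpow_nonneg (abs_nonneg _) _
    rw [abs_of_pos ht] at hle
    simp only [powerMap]
    generalize |s| ^ (δ - 1) = w at *
    generalize |t| ^ (δ - 1) = W at *
    rcases le_or_gt 0 s with h0 | h0
    · nlinarith
    · rw [abs_of_neg h0] at hle
      nlinarith
  rcases le_total |s| |t| with hle | hle
  · rw [max_eq_right (Real.rpow_le_rpow (abs_nonneg _) hle (by linarith))]
    exact key hst hle
  · rw [max_eq_left (Real.rpow_le_rpow (abs_nonneg _) hle (by linarith))]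
    have := key (neg_lt_neg hst) (by rwa [abs_neg, abs_neg])
    rw [powerMap_neg, powerMap_neg, abs_neg] at this
    linarith

lemma powerMap_strictMono {δ : ℝ} (hδ : 1 < δ) : StrictMono (powerMap δ) := by
  intro s t hst
  have h := le_powerMap_sub hδ hst
  have : 0 < max (|s| ^ (δ - 1)) (|t| ^ (δ - 1)) := by
    by_cases hs : s = 0
    · exact lt_max_of_lt_right (Real.rpow_pos_of_pos (abs_pos.2 (by linarith)) _)
    · exact lt_max_of_lt_left (Real.rpow_pos_of_pos (abs_pos.2 hs) _)
  nlinarith [mul_pos this (sub_pos.2 hst)]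

lemma powerMap_slope_le {δ : ℝ} (hδ : 1 < δ) {a s t e : ℝ} (has : a ≤ s) (hst : s < t)
    (hte : t ≤ e) : (powerMap δ t - powerMap δ s) * (e - a) ≤
      2 * δ * (powerMap δ e - powerMap δ a) * (t - s) := by
  have h1 := le_powerMap_sub hδ (s := a) (t := e) (by linarith)
  have hb : ∀ x, a ≤ x → x ≤ e → |x| ^ (δ - 1) ≤ max (|a| ^ (δ - 1)) (|e| ^ (δ - 1)) := by
    intro x hax hxe
    rcases le_max_iff.1 (abs_le_max_abs_abs hax hxe) with h | h
    · exact le_max_of_le_left (Real.rpow_le_rpow (abs_nonneg _) h (by linarith))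
    · exact le_max_of_le_right (Real.rpow_le_rpow (abs_nonneg _) h (by linarith))
  have h2 := powerMap_sub_le hδ hst (hb s has (by linarith)) (hb t (by linarith) hte)
  have hst' : 0 < t - s := sub_pos.2 hst
  calc (powerMap δ t - powerMap δ s) * (e - a)
      ≤ (δ * max (|a| ^ (δ - 1)) (|e| ^ (δ - 1)) * (t - s)) * (e - a) :=
        mul_le_mul_of_nonneg_right h2 (by linarith)
    _ = δ * (t - s) * (max (|a| ^ (δ - 1)) (|e| ^ (δ - 1)) * (e - a)) := by ring
    _ ≤ δ * (t - s) * (2 * (powerMap δ e - powerMap δ a)) :=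
        mul_le_mul_of_nonneg_left h1 (by positivity)
    _ = _ := by ring

lemma crossRatio_powerMap_le {δ : ℝ} (hδ : 1 < δ) {a b c e : ℝ} (hab : a < b) (hbc : b < c)
    (hce : c < e) : crossRatio (powerMap δ a) (powerMap δ b) (powerMap δ c) (powerMap δ e) ≤
      4 * δ ^ 2 * crossRatio a b c e := by
  have := crossRatio_le_of_slope_le (M := 2 * δ) ((powerMap_strictMono hδ).strictMonoOn _)
    hab hbc hce (powerMap_slope_le hδ le_rfl hab hbc.le) (powerMap_slope_le hδ hbc.le hce le_rfl)
  rwa [mul_pow, show (2 : ℝ) ^ 2 = 4 by norm_num] at this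

lemma sinh_mul_div_sinh_monotoneOn {δ : ℝ} (hδ : 1 < δ) :
    MonotoneOn (fun t => Real.sinh (δ * t) / Real.sinh t) (Ioi 0) := by
  have hlin : ∀ t : ℝ, HasDerivAt (fun t => δ * t) δ t := fun t => by
    simpa using (hasDerivAt_id t).const_mul δ
  have hs : ∀ t, HasDerivAt (fun t => Real.sinh (δ * t)) (Real.cosh (δ * t) * δ) t :=
    fun t => (hlin t).sinh
  have hc : ∀ t, HasDerivAt (fun t => Real.cosh (δ * t)) (Real.sinh (δ * t) * δ) t :=
    fun t => (hlin t).cosh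
  let N : ℝ → ℝ := fun t => Real.cosh (δ * t) * δ * Real.sinh t - Real.sinh (δ * t) * Real.cosh t
  have hN : ∀ t, HasDerivAt N ((δ ^ 2 - 1) * (Real.sinh (δ * t) * Real.sinh t)) t := by
    intro t
    refine ((((hc t).mul_const δ).mul (Real.hasDerivAt_sinh t)).sub
      ((hs t).mul (Real.hasDerivAt_cosh t))).congr_deriv ?_
    ring
  have hNmono : MonotoneOn N (Ici 0) := by
    refine monotoneOn_of_deriv_nonneg (convex_Ici 0)
      (fun t _ => (hN t).continuousAt.continuousWithinAt)
      (fun t _ => (hN t).differentiableAt.differentiableWithinAt) fun t ht => ?_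
    rw [interior_Ici, mem_Ioi] at ht
    rw [(hN t).deriv]
    have : 0 < δ * t := by positivity
    have := Real.sinh_pos_iff.2 this
    have := Real.sinh_pos_iff.2 ht
    exact mul_nonneg (by nlinarith) (by positivity)
  have hD : ∀ t ∈ Ioi (0 : ℝ), HasDerivAt (fun t => Real.sinh (δ * t) / Real.sinh t)
      (N t / Real.sinh t ^ 2) t := fun t ht =>
    (hs t).div (Real.hasDerivAt_sinh t) (Real.sinh_pos_iff.2 ht).ne'
  refine monotoneOn_of_deriv_nonneg (convex_Ioi 0)
    (fun t ht => (hD t ht).continuousAt.continuousWithinAt)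
    (fun t ht => (hD t (interior_subset ht)).differentiableAt.differentiableWithinAt)
    fun t ht => ?_
  rw [interior_Ioi] at ht
  rw [(hD t ht).deriv]
  have := hNmono self_mem_Ici (mem_Ici.2 (le_of_lt ht)) (le_of_lt ht)
  simp only [N, mul_zero, Real.sinh_zero, zero_mul, sub_zero] at this
  exact div_nonneg this (sq_nonneg _)

lemma exp_sub_exp_eq (u v : ℝ) :
    Real.exp (2 * v) - Real.exp (2 * u) = 2 * Real.exp (u + v) * Real.sinh (v - u) := by
  rw [Real.sinh_eq]
  have h1 : Real.exp (2 * v) = Real.exp (u + v) * Real.exp (v - u) := by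
    rw [← Real.exp_add]; ring_nf
  have h2 : Real.exp (2 * u) = Real.exp (u + v) * Real.exp (-(v - u)) := by
    rw [← Real.exp_add]; ring_nf
  rw [h1, h2]; ring

/-- Power maps contract cross-ratios away from their critical point. -/
lemma crossRatio_rpow_le {δ : ℝ} (hδ : 1 < δ) {a b c e : ℝ} (ha : 0 < a) (hab : a < b)
    (hbc : b < c) (hce : c < e) :
    crossRatio (a ^ δ) (b ^ δ) (c ^ δ) (e ^ δ) ≤ crossRatio a b c e := by
  have hpar : ∀ x : ℝ, 0 < x → ∃ u, x = Real.exp (2 * u) := fun x hx =>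
    ⟨Real.log x / 2, by rw [mul_div_cancel₀ _ two_ne_zero, Real.exp_log hx]⟩
  obtain ⟨a, rfl⟩ := hpar a ha
  obtain ⟨b, rfl⟩ := hpar b (ha.trans hab)
  obtain ⟨c, rfl⟩ := hpar c ((ha.trans hab).trans hbc)
  obtain ⟨e, rfl⟩ := hpar e (((ha.trans hab).trans hbc).trans hce)
  have hab : a < b := by linarith [Real.exp_lt_exp.1 hab]
  have hbc : b < c := by linarith [Real.exp_lt_exp.1 hbc]
  have hce : c < e := by linarith [Real.exp_lt_exp.1 hce]
  have hpow : ∀ u, Real.exp (2 * u) ^ δ = Real.exp (2 * (δ * u)) := fun u => by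
    rw [← Real.exp_mul]; ring_nf
  have hcr : ∀ a b c e : ℝ, crossRatio (Real.exp (2 * a)) (Real.exp (2 * b)) (Real.exp (2 * c))
      (Real.exp (2 * e)) = (Real.sinh (b - a) * Real.sinh (e - c)) /
        (Real.sinh (c - a) * Real.sinh (e - b)) := by
    intro a b c e
    have h1 : Real.exp (a + b) * Real.exp (c + e) = Real.exp (a + c) * Real.exp (b + e) := by
      rw [← Real.exp_add, ← Real.exp_add]; ring_nf
    have h2 := (Real.exp_pos (a + c)).ne'
    have h3 := (Real.exp_pos (b + e)).ne'
    rw [crossRatio, exp_sub_exp_eq, exp_sub_exp_eq, exp_sub_exp_eq, exp_sub_exp_eq,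
      show 2 * Real.exp (a + b) * Real.sinh (b - a) * (2 * Real.exp (c + e) * Real.sinh (e - c)) =
        (4 * (Real.exp (a + b) * Real.exp (c + e))) * (Real.sinh (b - a) * Real.sinh (e - c)) by
        ring,
      show 2 * Real.exp (a + c) * Real.sinh (c - a) * (2 * Real.exp (b + e) * Real.sinh (e - b)) =
        (4 * (Real.exp (a + c) * Real.exp (b + e))) * (Real.sinh (c - a) * Real.sinh (e - b)) by
        ring, h1, mul_div_mul_left _ _ (by positivity)]
  rw [hpow, hpow, hpow, hpow, hcr, hcr]
  simp only [← mul_sub]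
  have hpos : ∀ {x : ℝ}, 0 < x → 0 < Real.sinh x ∧ 0 < Real.sinh (δ * x) := fun hx =>
    ⟨Real.sinh_pos_iff.2 hx, Real.sinh_pos_iff.2 (by positivity)⟩
  have p1 := hpos (sub_pos.2 hab)
  have p2 := hpos (sub_pos.2 hce)
  have p3 := hpos (sub_pos.2 (hab.trans hbc))
  have p4 := hpos (sub_pos.2 (hbc.trans hce))
  have m1 := sinh_mul_div_sinh_monotoneOn hδ (mem_Ioi.2 (sub_pos.2 hab))
    (mem_Ioi.2 (sub_pos.2 (hab.trans hbc))) (by linarith)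
  have m2 := sinh_mul_div_sinh_monotoneOn hδ (mem_Ioi.2 (sub_pos.2 hce))
    (mem_Ioi.2 (sub_pos.2 (hbc.trans hce))) (by linarith)
  have m := mul_le_mul m1 m2 (div_pos p2.2 p2.1).le (div_pos p3.2 p3.1).le
  simp only [div_mul_div_comm] at m
  rw [div_le_div_iff₀ (mul_pos p1.1 p2.1) (mul_pos p3.1 p4.1)] at m
  rw [div_le_div_iff₀ (mul_pos p3.2 p4.2) (mul_pos p3.1 p4.1)]
  linarith

lemma crossRatio_powerMap_le_of_nonneg {δ : ℝ} (hδ : 1 < δ) {a b c e : ℝ} (ha : 0 ≤ a)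
    (hab : a < b) (hbc : b < c) (hce : c < e) :
    crossRatio (powerMap δ a) (powerMap δ b) (powerMap δ c) (powerMap δ e) ≤
      crossRatio a b c e := by
  have hb : 0 < b := ha.trans_lt hab
  have hc : 0 < c := hb.trans hbc
  have he : 0 < e := hc.trans hce
  rw [powerMap_of_nonneg hδ ha, powerMap_of_nonneg hδ hb.le, powerMap_of_nonneg hδ hc.le,
    powerMap_of_nonneg hδ he.le]
  rcases ha.lt_or_eq with ha | rfl
  · exact crossRatio_rpow_le hδ ha hab hbc hce
  have hcont : ContinuousAt (fun x : ℝ => x ^ δ) 0 :=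
    Real.continuousAt_rpow_const _ _ (Or.inr (by linarith))
  have hbc' : b ^ δ < c ^ δ := Real.rpow_lt_rpow hb.le hbc (by linarith)
  have hce' : c ^ δ < e ^ δ := Real.rpow_lt_rpow hc.le hce (by linarith)
  have h0 : (0 : ℝ) ^ δ = 0 := Real.zero_rpow (by linarith)
  have hc' : 0 < c ^ δ := by positivity
  have hlim : ∀ {g : ℝ → ℝ} {b c e : ℝ}, ContinuousAt g 0 → c - g 0 ≠ 0 → e - b ≠ 0 →
      Tendsto (fun x => crossRatio (g x) b c e) (𝓝[>] 0) (𝓝 (crossRatio (g 0) b c e)) := by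
    intro g b c e hg h1 h2
    have : ContinuousAt (fun x => crossRatio (g x) b c e) 0 := by
      simp only [crossRatio]
      exact ((continuousAt_const.sub hg).mul continuousAt_const).div
        ((continuousAt_const.sub hg).mul continuousAt_const) (mul_ne_zero h1 h2)
    exact this.tendsto.mono_left nhdsWithin_le_nhds
  refine le_of_tendsto_of_tendsto
    (hlim hcont (by rw [h0]; linarith) (by linarith))
    (hlim (g := fun x => x) continuousAt_id (by linarith) (by linarith)) ?_
  filter_upwards [Ioo_mem_nhdsGT hb] with x hx
  exact crossRatio_rpow_le hδ hx.1 hx.2 hbc hce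

lemma crossRatio_powerMap_le_of_notMem {δ : ℝ} (hδ : 1 < δ) {a b c e : ℝ} (h0 : 0 ∉ Ioo a e)
    (hab : a < b) (hbc : b < c) (hce : c < e) :
    crossRatio (powerMap δ a) (powerMap δ b) (powerMap δ c) (powerMap δ e) ≤
      crossRatio a b c e := by
  rcases le_or_gt 0 a with ha | ha
  · exact crossRatio_powerMap_le_of_nonneg hδ ha hab hbc hce
  · have he : e ≤ 0 := not_lt.1 fun he => h0 ⟨ha, he⟩
    have := crossRatio_powerMap_le_of_nonneg hδ (neg_nonneg.2 he) (neg_lt_neg hce)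
      (neg_lt_neg hbc) (neg_lt_neg hab)
    rwa [powerMap_neg, powerMap_neg, powerMap_neg, powerMap_neg, crossRatio_neg,
      crossRatio_neg] at this

end MCircle

namespace MCircle

/-! ### Local bounds for diffeomorphisms -/

/-- Near `y`, the function `φ` is of class `C^{2,1}` with explicit bounds, and its derivative is
between `m` and `M`. -/
structure HasLocalBounds (φ : ℝ → ℝ) (y r L m M : ℝ) : Prop where
  pos : 0 < r
  le_one : r ≤ 1 / 2
  nonneg : 0 ≤ L
  hasDerivAt : ∀ x ∈ Ioo (y - r) (y + r), HasDerivAt φ (deriv φ x) x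
  hasDerivAt_deriv : ∀ x ∈ Ioo (y - r) (y + r), HasDerivAt (deriv φ) (deriv (deriv φ) x) x
  lipschitz : ∀ x ∈ Ioo (y - r) (y + r), ∀ x' ∈ Ioo (y - r) (y + r),
    |deriv (deriv φ) x - deriv (deriv φ) x'| ≤ L * |x - x'|
  abs_deriv_deriv_le : ∀ x ∈ Ioo (y - r) (y + r), |deriv (deriv φ) x| ≤ L
  le_deriv : ∀ x ∈ Ioo (y - r) (y + r), m ≤ deriv φ x
  deriv_le : ∀ x ∈ Ioo (y - r) (y + r), deriv φ x ≤ M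

lemma exists_hasLocalBounds {φ : ℝ → ℝ} {W : Set ℝ} (hφ : ContDiffOn ℝ 3 φ W) (hW : IsOpen W)
    {y : ℝ} (hy : y ∈ W) {m M : ℝ} (hm : m < deriv φ y) (hM : deriv φ y < M) {t : Set ℝ}
    (ht : t ∈ 𝓝 y) :
    ∃ r L, HasLocalBounds φ y r L m M ∧ Ioo (y - r) (y + r) ⊆ t := by
  have h2 : ContDiffOn ℝ 2 (deriv φ) W := hφ.deriv_of_isOpen hW (by norm_num)
  have h1 : ContDiffOn ℝ 1 (deriv (deriv φ)) W := h2.deriv_of_isOpen hW (by norm_num)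
  have hWy : W ∈ 𝓝 y := hW.mem_nhds hy
  obtain ⟨K, s, hs, hK⟩ := (h1.contDiffAt hWy).exists_lipschitzOnWith
  have hc1 : ContinuousAt (deriv φ) y := h2.continuousOn.continuousAt hWy
  have hc2 : ContinuousAt (deriv (deriv φ)) y := h1.continuousOn.continuousAt hWy
  have hev : ∀ᶠ x in 𝓝 y, x ∈ W ∧ x ∈ s ∧ x ∈ t ∧ m < deriv φ x ∧ deriv φ x < M ∧
      |deriv (deriv φ) x| < |deriv (deriv φ) y| + 1 :=
    (eventually_mem_set.2 hWy).and <| (eventually_mem_set.2 hs).and <|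
      (eventually_mem_set.2 ht).and <| (hc1.eventually (lt_mem_nhds hm)).and <|
      (hc1.eventually (gt_mem_nhds hM)).and (hc2.abs.eventually (gt_mem_nhds (lt_add_one _)))
  obtain ⟨r, hr, hball⟩ := Metric.eventually_nhds_iff_ball.1 hev
  set r' := min r (1 / 2)
  have hr' : 0 < r' := lt_min hr (by norm_num)
  have hb : ∀ x ∈ Ioo (y - r') (y + r'), _ := fun x hx => hball x (by
    rw [Real.ball_eq_Ioo]
    exact ⟨by linarith [hx.1, min_le_left r (1 / 2)], by linarith [hx.2, min_le_left r (1 / 2)]⟩)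
  refine ⟨r', max K (|deriv (deriv φ) y| + 1), ⟨hr', min_le_right _ _,
    le_max_of_le_left K.coe_nonneg, ?_, ?_, ?_, ?_, ?_, ?_⟩, fun x hx => (hb x hx).2.2.1⟩
  · intro x hx
    exact ((hφ.contDiffAt (hW.mem_nhds (hb x hx).1)).differentiableAt (by norm_num)).hasDerivAt
  · intro x hx
    exact ((h2.contDiffAt (hW.mem_nhds (hb x hx).1)).differentiableAt (by norm_num)).hasDerivAt
  · intro x hx x' hx'
    have := hK.dist_le_mul x (hb x hx).2.1 x' (hb x' hx').2.1
    rw [Real.dist_eq, Real.dist_eq] at this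
    exact this.trans (mul_le_mul_of_nonneg_right (le_max_left _ _) (abs_nonneg _))
  · exact fun x hx => (hb x hx).2.2.2.2.2.le.trans (le_max_right _ _)
  · exact fun x hx => (hb x hx).2.2.2.1.le
  · exact fun x hx => (hb x hx).2.2.2.2.1.le

lemma abs_sub_sub_le_of_hasDerivAt {g g' : ℝ → ℝ} {a e C k : ℝ}
    (hg : ∀ x ∈ Icc a e, HasDerivAt g (g' x) x) (hb : ∀ x ∈ Icc a e, |g' x - k| ≤ C) {s t : ℝ}
    (has : a ≤ s) (hst : s ≤ t) (hte : t ≤ e) : |g t - g s - k * (t - s)| ≤ C * (t - s) := by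
  have := (convex_Icc a e).norm_image_sub_le_of_norm_hasDerivWithin_le
    (f := fun x => g x - k * x) (f' := fun x => g' x - k) (C := C)
    (fun x hx => by
      simpa using (HasDerivAt.fun_sub (hg x hx)
        ((hasDerivAt_id' x).const_mul k)).hasDerivWithinAt) hb
    (show s ∈ Icc a e from ⟨has, by linarith⟩) (show t ∈ Icc a e from ⟨by linarith, hte⟩)
  rw [Real.norm_eq_abs, Real.norm_eq_abs, abs_of_nonneg (sub_nonneg.2 hst)] at this
  rwa [show g t - g s - k * (t - s) = g t - k * t - (g s - k * s) by ring]

namespace HasLocalBounds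

variable {φ : ℝ → ℝ} {y r L m M : ℝ}

lemma slope_bounds (h : HasLocalBounds φ y r L m M) {s t : ℝ} (hs : y - r < s) (hst : s < t)
    (ht : t < y + r) : m * (t - s) ≤ φ t - φ s ∧ φ t - φ s ≤ M * (t - s) := by
  have hsub : ∀ x ∈ Icc s t, x ∈ Ioo (y - r) (y + r) := fun x hx =>
    ⟨hs.trans_le hx.1, hx.2.trans_lt ht⟩
  obtain ⟨x, hx, hslope⟩ := exists_hasDerivAt_eq_slope φ (deriv φ) hst
    (fun x hx => (h.hasDerivAt x (hsub x hx)).continuousAt.continuousWithinAt)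
    (fun x hx => h.hasDerivAt x (hsub x (Ioo_subset_Icc_self hx)))
  rw [eq_div_iff (sub_pos.2 hst).ne'] at hslope
  have hx' := hsub x (Ioo_subset_Icc_self hx)
  rw [← hslope]
  exact ⟨mul_le_mul_of_nonneg_right (h.le_deriv x hx') (sub_pos.2 hst).le,
    mul_le_mul_of_nonneg_right (h.deriv_le x hx') (sub_pos.2 hst).le⟩

lemma strictMonoOn (h : HasLocalBounds φ y r L m M) (hm : 0 < m) :
    StrictMonoOn φ (Ioo (y - r) (y + r)) := fun s hs t ht hst => by
  have := (h.slope_bounds hs.1 hst ht.2).1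
  nlinarith [mul_pos hm (sub_pos.2 hst)]

lemma slope_le (h : HasLocalBounds φ y r L m M) (hm : 0 < m) {a s t e : ℝ} (ha : y - r < a)
    (has : a ≤ s) (hst : s < t) (hte : t ≤ e) (he : e < y + r) :
    (φ t - φ s) * (e - a) ≤ M / m * (φ e - φ a) * (t - s) := by
  have h1 := (h.slope_bounds (ha.trans_le has) hst (hte.trans_lt he)).2
  have h2 := (h.slope_bounds ha ((has.trans_lt hst).trans_le hte) he).1
  have hst' : 0 < t - s := sub_pos.2 hst
  have hM : 0 < M := by
    have : 0 < φ t - φ s := sub_pos.2 (h.strictMonoOn hm ⟨ha.trans_le has, by linarith⟩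
      ⟨by linarith, hte.trans_lt he⟩ hst)
    by_contra! hM
    nlinarith
  calc (φ t - φ s) * (e - a) ≤ (M * (t - s)) * (e - a) :=
        mul_le_mul_of_nonneg_right h1 (by linarith)
    _ = M / m * (t - s) * (m * (e - a)) := by field_simp
    _ ≤ M / m * (t - s) * (φ e - φ a) := mul_le_mul_of_nonneg_left h2 (by positivity)
    _ = _ := by ring

lemma exists_slope_eq (h : HasLocalBounds φ y r L m M) {a e s t : ℝ} (ha : y - r < a)
    (he : e < y + r) (has : a ≤ s) (hst : s < t) (hte : t ≤ e) :
    ∃ ε, |ε| ≤ L * (e - a) ^ 2 ∧ φ t - φ s =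
      (deriv φ a + deriv (deriv φ) a * ((s + t) / 2 - a) + ε) * (t - s) := by
  have hsub : ∀ x ∈ Icc a e, x ∈ Ioo (y - r) (y + r) := fun x hx =>
    ⟨ha.trans_le hx.1, hx.2.trans_lt he⟩
  have hae : a ≤ e := by linarith
  have haa : a ∈ Icc a e := left_mem_Icc.2 hae
  set k := deriv (deriv φ) a
  have h1 : ∀ x ∈ Icc a e, |deriv φ x - deriv φ a - k * (x - a)| ≤ L * (e - a) ^ 2 := by
    intro x hx
    have := abs_sub_sub_le_of_hasDerivAt (C := L * (e - a)) (k := k)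
      (fun x hx => h.hasDerivAt_deriv x (hsub x hx)) (fun x hx => by
        refine (h.lipschitz x (hsub x hx) a (hsub a haa)).trans ?_
        rw [abs_of_nonneg (sub_nonneg.2 hx.1)]
        exact mul_le_mul_of_nonneg_left (by linarith [hx.2]) h.nonneg) le_rfl hx.1 hx.2
    refine this.trans ?_
    rw [pow_two, ← mul_assoc]
    exact mul_le_mul_of_nonneg_left (by linarith [hx.2])
      (mul_nonneg h.nonneg (sub_nonneg.2 hae))
  have h2 := abs_sub_sub_le_of_hasDerivAt (g := fun x => φ x - k * (x - a) ^ 2 / 2)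
    (g' := fun x => deriv φ x - k * (x - a)) (k := deriv φ a) (C := L * (e - a) ^ 2)
    (fun x hx => by
      refine ((h.hasDerivAt x (hsub x hx)).sub
        (((((hasDerivAt_id x).sub_const a).pow 2).const_mul k).div_const 2)).congr_deriv ?_
      simp only [id]; ring)
    (fun x hx => by
      rw [show deriv φ x - k * (x - a) - deriv φ a = deriv φ x - deriv φ a - k * (x - a) by ring]
      exact h1 x hx) has hst.le hte
  have hst' : 0 < t - s := sub_pos.2 hst
  refine ⟨(φ t - φ s) / (t - s) - (deriv φ a + k * ((s + t) / 2 - a)), ?_, ?_⟩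
  · rw [← mul_le_mul_iff_left₀ hst', ← abs_of_pos hst', ← abs_mul, abs_of_pos hst']
    refine le_of_eq_of_le (congrArg _ ?_) h2
    rw [sub_mul, div_mul_cancel₀ _ hst'.ne']
    ring
  · rw [add_sub_cancel, div_mul_cancel₀ _ hst'.ne']

/-- Cross-ratio distortion of a diffeomorphism is controlled by the square of the length. -/
lemma crossRatio_le (h : HasLocalBounds φ y r L m M) (hm : 0 < m) {a b c e : ℝ} (ha : y - r < a)
    (hab : a < b) (hbc : b < c) (hce : c < e) (he : e < y + r) :
    crossRatio (φ a) (φ b) (φ c) (φ e) ≤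
      Real.exp ((4 * M * L + 8 * L ^ 2) / m ^ 2 * (e - a) ^ 2) * crossRatio a b c e := by
  set T := e - a with hT
  have hT0 : 0 < T := by linarith
  have hT1 : T ≤ 1 := by linarith [h.le_one]
  have haB : a ∈ Ioo (y - r) (y + r) := ⟨ha, by linarith⟩
  have hL := h.nonneg
  set P := deriv φ a with hP
  set k := deriv (deriv φ) a with hk
  have hP0 : m ≤ P := h.le_deriv a haB
  have hPM : P ≤ M := h.deriv_le a haB
  have hkL : |k| ≤ L := h.abs_deriv_deriv_le a haB
  have hslope : ∀ s t, a ≤ s → s < t → t ≤ e → ∃ u, |u - k * ((s + t) / 2 - a)| ≤ L * T ^ 2 ∧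
      |u| ≤ 2 * L * T ∧ m ≤ P + u ∧ φ t - φ s = (P + u) * (t - s) := by
    intro s t has hst hte
    obtain ⟨ε, hε, heq⟩ := h.exists_slope_eq ha he has hst hte
    refine ⟨k * ((s + t) / 2 - a) + ε, by rwa [add_sub_cancel_left], ?_, ?_, by rw [heq]; ring⟩
    · refine (abs_add_le _ _).trans ?_
      rw [abs_mul, abs_of_nonneg (show 0 ≤ (s + t) / 2 - a by linarith)]
      have h1 : |k| * ((s + t) / 2 - a) ≤ L * T :=
        mul_le_mul hkL (by linarith) (by linarith) hL
      have h2 : L * T ^ 2 ≤ L * T := mul_le_mul_of_nonneg_left (by nlinarith) hL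
      linarith
    · have := (h.slope_bounds (ha.trans_le has) hst (hte.trans_lt he)).1
      rw [heq] at this
      have := le_of_mul_le_mul_right this (sub_pos.2 hst)
      linarith
  obtain ⟨u₁, a₁, b₁, c₁, e₁⟩ := hslope a b le_rfl hab (by linarith)
  obtain ⟨u₂, a₂, b₂, c₂, e₂⟩ := hslope c e (by linarith) hce le_rfl
  obtain ⟨u₃, a₃, b₃, c₃, e₃⟩ := hslope a c le_rfl (by linarith) (by linarith)
  obtain ⟨u₄, a₄, b₄, c₄, e₄⟩ := hslope b e (by linarith) (by linarith) le_rfl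
  have hsum : u₁ + u₂ - u₃ - u₄ ≤ 4 * L * T ^ 2 := by
    rw [abs_le] at a₁ a₂ a₃ a₄
    linarith [a₁.2, a₂.2, a₃.1, a₄.1]
  have hprod : ∀ {u v : ℝ}, |u| ≤ 2 * L * T → |v| ≤ 2 * L * T → |u * v| ≤ 4 * L ^ 2 * T ^ 2 := by
    intro u v hu hv
    rw [abs_mul]
    refine (mul_le_mul hu hv (abs_nonneg _) (by positivity)).trans (le_of_eq (by ring))
  have hp₁ := (abs_le.1 (hprod b₁ b₂)).2
  have hp₂ := (abs_le.1 (hprod b₃ b₄)).1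
  have hmm : m ^ 2 ≤ (P + u₃) * (P + u₄) := by
    rw [pow_two]; exact mul_le_mul c₃ c₄ hm.le (by linarith)
  have hmain : (P + u₁) * (P + u₂) ≤ (P + u₃) * (P + u₄) + (4 * M * L + 8 * L ^ 2) * T ^ 2 := by
    have : P * (u₁ + u₂ - u₃ - u₄) ≤ M * (4 * L * T ^ 2) :=
      (mul_le_mul_of_nonneg_left hsum (by linarith)).trans
        (mul_le_mul_of_nonneg_right hPM (by positivity))
    linarith
  set C := (4 * M * L + 8 * L ^ 2) / m ^ 2 with hC
  have hM : 0 < M := by linarith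
  have hC0 : 0 ≤ C := by positivity
  have hCm : (4 * M * L + 8 * L ^ 2) = C * m ^ 2 := by rw [hC]; field_simp
  have hexp : (P + u₁) * (P + u₂) ≤ Real.exp (C * T ^ 2) * ((P + u₃) * (P + u₄)) := by
    have h1 := Real.add_one_le_exp (C * T ^ 2)
    have h2 : C * m ^ 2 * T ^ 2 ≤ C * T ^ 2 * ((P + u₃) * (P + u₄)) := by
      rw [mul_right_comm]
      exact mul_le_mul_of_nonneg_left hmm (by positivity)
    have h3 := mul_le_mul_of_nonneg_right h1 ((sq_nonneg m).trans hmm)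
    rw [hCm] at hmain
    linarith
  rw [crossRatio, crossRatio, e₁, e₂, e₃, e₄, ← mul_div_assoc]
  have i₁ : 0 < b - a := by linarith
  have i₂ : 0 < e - c := by linarith
  have i₃ : 0 < c - a := by linarith
  have i₄ : 0 < e - b := by linarith
  have j₃ : 0 < P + u₃ := by linarith
  have j₄ : 0 < P + u₄ := by linarith
  rw [div_le_div_iff₀ (by positivity) (by positivity)]
  calc (P + u₁) * (b - a) * ((P + u₂) * (e - c)) * ((c - a) * (e - b))
      = (P + u₁) * (P + u₂) * ((b - a) * (e - c) * ((c - a) * (e - b))) := by ring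
    _ ≤ Real.exp (C * T ^ 2) * ((P + u₃) * (P + u₄)) *
        ((b - a) * (e - c) * ((c - a) * (e - b))) :=
      mul_le_mul_of_nonneg_right hexp (by positivity)
    _ = _ := by ring

end HasLocalBounds

end MCircle

namespace MCircle

/-! ### Local distortion of multicritical maps -/

/-- Bounds for the distortion of `f` on the interval `[a, e]`. -/
structure DistortionControl (f : ℝ → ℝ) (Z : Finset ℝ) (K C a e : ℝ) : Prop where
  le : ∀ b c, a < b → b < c → c < e →
    crossRatio (f a) (f b) (f c) (f e) ≤ K * Real.exp (C * (e - a) ^ 2) * crossRatio a b c e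
  le_of_disjoint : (¬ ∃ z ∈ Z, ∃ k : ℤ, z + k ∈ Ioo a e) → ∀ b c, a < b → b < c → c < e →
    crossRatio (f a) (f b) (f c) (f e) ≤ Real.exp (C * (e - a) ^ 2) * crossRatio a b c e
  slope_le : ∀ s t, a ≤ s → s < t → t ≤ e →
    (f t - f s) * (e - a) ≤ C * (f e - f a) * (t - s)

lemma DistortionControl.mono {f : ℝ → ℝ} (hf : StrictMono f) {Z : Finset ℝ} {K C C' a e : ℝ}
    (hK : 0 ≤ K) (hC : C ≤ C') (h : DistortionControl f Z K C a e) :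
    DistortionControl f Z K C' a e := by
  have hexp : Real.exp (C * (e - a) ^ 2) ≤ Real.exp (C' * (e - a) ^ 2) :=
    Real.exp_le_exp.2 (mul_le_mul_of_nonneg_right hC (sq_nonneg _))
  refine ⟨fun b c h1 h2 h3 => (h.le b c h1 h2 h3).trans ?_,
    fun hd b c h1 h2 h3 => (h.le_of_disjoint hd b c h1 h2 h3).trans ?_,
    fun s t h1 h2 h3 => (h.slope_le s t h1 h2 h3).trans ?_⟩
  · exact mul_le_mul_of_nonneg_right (mul_le_mul_of_nonneg_left hexp hK)
      (crossRatio_pos h1 h2 h3).le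
  · exact mul_le_mul_of_nonneg_right hexp (crossRatio_pos h1 h2 h3).le
  · have : f a ≤ f e := hf.monotone (by linarith)
    exact mul_le_mul_of_nonneg_right (mul_le_mul_of_nonneg_right hC (sub_nonneg.2 this))
      (sub_pos.2 h2).le

lemma DistortionControl.add_int {f : ℝ → ℝ} (hf : ∀ x (k : ℤ), f (x + k) = f x + k)
    {Z : Finset ℝ} {K C a e : ℝ} (k : ℤ) (h : DistortionControl f Z K C a e) :
    DistortionControl f Z K C (a + k) (e + k) := by
  have hfk : ∀ x, f x = f (x - k) + k := fun x => by rw [← hf, sub_add_cancel]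
  have hcr : ∀ a b c e : ℝ, crossRatio (a + k) (b + k) (c + k) (e + k) = crossRatio a b c e :=
    fun a b c e => by simpa using crossRatio_sub a b c e (-k)
  have hcr' : ∀ b c : ℝ, crossRatio (a + k) b c (e + k) = crossRatio a (b - k) (c - k) e :=
    fun b c => by simpa using hcr a (b - k) (c - k) e
  have hlen : e + k - (a + k) = e - a := by ring
  refine ⟨fun b c h1 h2 h3 => ?_, fun hd b c h1 h2 h3 => ?_, fun s t h1 h2 h3 => ?_⟩
  · rw [hf, hf, hfk b, hfk c, hcr, hcr', hlen]
    exact h.le _ _ (by linarith) (by linarith) (by linarith)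
  · rw [hf, hf, hfk b, hfk c, hcr, hcr', hlen]
    refine h.le_of_disjoint ?_ _ _ (by linarith) (by linarith) (by linarith)
    rintro ⟨z, hz, l, hl⟩
    refine hd ⟨z, hz, l + k, ?_⟩
    push_cast
    exact ⟨by linarith [hl.1], by linarith [hl.2]⟩
  · have := h.slope_le (s - k) (t - k) (by linarith) (by linarith) (by linarith)
    rw [hf, hf, hfk s, hfk t, hlen]
    linarith

lemma HasLocalBounds.distortionControl {f : ℝ → ℝ} {y r L m M K : ℝ}
    (h : HasLocalBounds f y r L m M) (hf : StrictMono f) (hm : 0 < m) (Z : Finset ℝ)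
    (hK : 1 ≤ K) :
    ∃ C, ∀ a e, y - r < a → a < e → e < y + r → DistortionControl f Z K C a e := by
  have hK0 : 0 ≤ K := by linarith
  refine ⟨max ((4 * M * L + 8 * L ^ 2) / m ^ 2) (M / m), fun a e ha hae he => ?_⟩
  have key : ∀ b c, a < b → b < c → c < e → crossRatio (f a) (f b) (f c) (f e) ≤
      Real.exp (max ((4 * M * L + 8 * L ^ 2) / m ^ 2) (M / m) * (e - a) ^ 2) *
        crossRatio a b c e := fun b c h1 h2 h3 =>
    (h.crossRatio_le hm ha h1 h2 h3 he).trans (mul_le_mul_of_nonneg_right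
      (Real.exp_le_exp.2 (mul_le_mul_of_nonneg_right (le_max_left _ _) (sq_nonneg _)))
      (crossRatio_pos h1 h2 h3).le)
  refine ⟨fun b c h1 h2 h3 => (key b c h1 h2 h3).trans ?_, fun _ => key, fun s t h1 h2 h3 => ?_⟩
  · have := crossRatio_pos h1 h2 h3
    rw [mul_assoc K]
    exact le_mul_of_one_le_left (by positivity) hK
  · refine (h.slope_le hm ha h1 h2 h3 he).trans ?_
    exact mul_le_mul_of_nonneg_right (mul_le_mul_of_nonneg_right (le_max_right _ _)
      (sub_pos.2 (hf hae)).le) (sub_pos.2 h2).le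

lemma IsNonFlatCritPt.exists_hasLocalBounds {f : ℝ → ℝ} (hf : StrictMono f) {c δ : ℝ}
    (h : IsNonFlatCritPt f c δ) : ∃ φ r L m M, HasLocalBounds φ c r L m M ∧ 0 < m ∧ M ≤ 2 * m ∧
      φ c = 0 ∧ ∀ x ∈ Ioo (c - r) (c + r), f x = f c + powerMap δ (φ x) := by
  obtain ⟨hδ, W, φ, hW, hcW, hφ, hφc, hd, -, hfφ⟩ := h
  have hpos : 0 < deriv φ c := by
    by_contra! hneg
    have hneg : deriv φ c < 0 := lt_of_le_of_ne hneg (hd c hcW)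
    obtain ⟨r, L, hb, hrW⟩ := MCircle.exists_hasLocalBounds hφ hW hcW (sub_one_lt _)
      (show deriv φ c < deriv φ c / 2 by linarith) (hW.mem_nhds hcW)
    have hr := hb.pos
    have h1 := (hb.slope_bounds (s := c) (t := c + r / 2) (by linarith) (by linarith)
      (by linarith)).2
    have h2 : φ (c + r / 2) < 0 := by rw [hφc] at h1; nlinarith
    have h3 := powerMap_strictMono hδ h2
    have h4 := hfφ (c + r / 2) (hrW ⟨by linarith, by linarith⟩)
    have h5 : f c < f (c + r / 2) := hf (by linarith)
    simp only [powerMap, zero_mul] at h3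
    linarith
  obtain ⟨r, L, hb, hrW⟩ := MCircle.exists_hasLocalBounds hφ hW hcW
    (show deriv φ c * (3 / 4) < deriv φ c by linarith)
    (show deriv φ c < deriv φ c * (3 / 2) by linarith) (hW.mem_nhds hcW)
  exact ⟨φ, r, L, _, _, hb, by linarith, by linarith, hφc, fun x hx => hfφ x (hrW hx)⟩

lemma IsNonFlatCritPt.distortionControl {f : ℝ → ℝ} (hf : StrictMono f) {Z : Finset ℝ}
    {c δ K : ℝ} (h : IsNonFlatCritPt f c δ) (hc : c ∈ Z) (hK : 4 * δ ^ 2 ≤ K) :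
    ∃ r > 0, ∃ C, ∀ a e, c - r < a → a < e → e < c + r → DistortionControl f Z K C a e := by
  obtain ⟨φ, r, L, m, M, hb, hm, -, hφc, hfφ⟩ := h.exists_hasLocalBounds hf
  have hδ : 1 < δ := h.1
  refine ⟨r, hb.pos, max ((4 * M * L + 8 * L ^ 2) / m ^ 2) (2 * δ * (M / m)),
    fun a e ha hae he => ?_⟩
  have hmem : ∀ x, a ≤ x → x ≤ e → x ∈ Ioo (c - r) (c + r) := fun x h1 h2 =>
    ⟨ha.trans_le h1, h2.trans_lt he⟩
  have hφm : ∀ x z, a ≤ x → x < z → z ≤ e → φ x < φ z := fun x z h1 h2 h3 =>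
    hb.strictMonoOn hm (hmem x h1 (by linarith)) (hmem z (by linarith) h3) h2
  have hfd : ∀ x, a ≤ x → x ≤ e → f x = f c + powerMap δ (φ x) := fun x h1 h2 =>
    hfφ x (hmem x h1 h2)
  have hcr : ∀ b b', a < b → b < b' → b' < e → crossRatio (f a) (f b) (f b') (f e) =
      crossRatio (powerMap δ (φ a)) (powerMap δ (φ b)) (powerMap δ (φ b')) (powerMap δ (φ e)) := by
    intro b b' h1 h2 h3
    rw [hfd a le_rfl hae.le, hfd b h1.le (by linarith), hfd b' (by linarith) h3.le,
      hfd e hae.le le_rfl]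
    simp only [crossRatio, add_sub_add_left_eq_sub]
  have hφcr : ∀ b b', a < b → b < b' → b' < e → crossRatio (φ a) (φ b) (φ b') (φ e) ≤
      Real.exp (max ((4 * M * L + 8 * L ^ 2) / m ^ 2) (2 * δ * (M / m)) * (e - a) ^ 2) *
        crossRatio a b b' e := fun b b' h1 h2 h3 =>
    (hb.crossRatio_le hm ha h1 h2 h3 he).trans (mul_le_mul_of_nonneg_right
      (Real.exp_le_exp.2 (mul_le_mul_of_nonneg_right (le_max_left _ _) (sq_nonneg _)))
      (crossRatio_pos h1 h2 h3).le)
  refine ⟨fun b b' h1 h2 h3 => ?_, fun hd b b' h1 h2 h3 => ?_, fun s t h1 h2 h3 => ?_⟩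
  · rw [hcr b b' h1 h2 h3]
    have k1 := hφm a b le_rfl h1 (by linarith)
    have k2 := hφm b b' h1.le h2 (by linarith)
    have k3 := hφm b' e (by linarith) h3 le_rfl
    refine (crossRatio_powerMap_le hδ k1 k2 k3).trans ?_
    rw [mul_assoc K]
    exact mul_le_mul hK (hφcr b b' h1 h2 h3) (crossRatio_pos k1 k2 k3).le
      ((by positivity : (0 : ℝ) ≤ 4 * δ ^ 2).trans hK)
  · rw [hcr b b' h1 h2 h3]
    refine (crossRatio_powerMap_le_of_notMem hδ (fun h0 => hd ⟨c, hc, 0, ?_⟩)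
      (hφm a b le_rfl h1 (by linarith)) (hφm b b' h1.le h2 (by linarith))
      (hφm b' e (by linarith) h3 le_rfl)).trans (hφcr b b' h1 h2 h3)
    rw [← hφc] at h0
    have hcm : c ∈ Ioo (c - r) (c + r) := ⟨by linarith [hb.pos], by linarith [hb.pos]⟩
    have hiff := fun {x z} hx hz => (hb.strictMonoOn hm).lt_iff_lt (a := x) (b := z) hx hz
    rw [Int.cast_zero, add_zero]
    exact ⟨(hiff (hmem a le_rfl hae.le) hcm).1 h0.1, (hiff hcm (hmem e hae.le le_rfl)).1 h0.2⟩
  · have hst := sub_pos.2 h2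
    have hea := sub_pos.2 hae
    have hφst := sub_pos.2 (hφm s t h1 h2 h3)
    have hφae := sub_pos.2 (hφm a e le_rfl hae le_rfl)
    have hfae := sub_pos.2 (hf hae)
    have k1 := powerMap_slope_le hδ ((hb.strictMonoOn hm).monotoneOn (hmem a le_rfl hae.le)
      (hmem s h1 (by linarith)) h1) (hφm s t h1 h2 h3) ((hb.strictMonoOn hm).monotoneOn
      (hmem t (by linarith) h3) (hmem e hae.le le_rfl) h3)
    have k2 := hb.slope_le hm ha h1 h2 h3 he
    have e1 : powerMap δ (φ t) - powerMap δ (φ s) = f t - f s := by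
      rw [hfd t (by linarith) h3, hfd s h1 (by linarith)]; ring
    have e2 : powerMap δ (φ e) - powerMap δ (φ a) = f e - f a := by
      rw [hfd a le_rfl hae.le, hfd e hae.le le_rfl]; ring
    rw [e1, e2] at k1
    have k3 : (f t - f s) * (e - a) ≤ 2 * δ * (M / m) * (f e - f a) * (t - s) := by
      refine le_of_mul_le_mul_right ?_ hφae
      calc (f t - f s) * (e - a) * (φ e - φ a) = ((f t - f s) * (φ e - φ a)) * (e - a) := by ring
        _ ≤ (2 * δ * (f e - f a) * (φ t - φ s)) * (e - a) := mul_le_mul_of_nonneg_right k1 hea.le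
        _ = 2 * δ * (f e - f a) * ((φ t - φ s) * (e - a)) := by ring
        _ ≤ 2 * δ * (f e - f a) * (M / m * (φ e - φ a) * (t - s)) :=
          mul_le_mul_of_nonneg_left k2 (by positivity)
        _ = _ := by ring
    exact k3.trans (mul_le_mul_of_nonneg_right (mul_le_mul_of_nonneg_right (le_max_right _ _)
      hfae.le) hst.le)

lemma IsCircleMapLift.add_int {f : ℝ → ℝ} (hf : IsCircleMapLift f) (x : ℝ) (k : ℤ) :
    f (x + k) = f x + k :=
  CircleDeg1Lift.map_add_int ⟨⟨f, hf.mono.monotone⟩, hf.periodic⟩ x k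

lemma IsMulticriticalLift.exists_distortionControl {f : ℝ → ℝ} {Z : Finset ℝ} {dc : ℝ → ℝ}
    (h : IsMulticriticalLift f Z dc) {d : ℝ} (hd : ∀ c ∈ Z, dc c ≤ d) (h1d : 1 < d) :
    ∃ δ > 0, ∃ C, ∀ a e, a < e → e - a ≤ δ → DistortionControl f Z (4 * d ^ 2) C a e := by
  obtain ⟨hf, -, hsub, hcrit, hnf⟩ := h
  have hK : 1 ≤ 4 * d ^ 2 := by nlinarith
  refine exists_uniform_of_local (DistortionControl f Z (4 * d ^ 2))
    (fun hC h => h.mono hf.mono (by linarith) hC) (fun k h => h.add_int hf.add_int k)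
    fun y hy => ?_
  by_cases hyZ : y ∈ Z
  · refine (hnf y hyZ).distortionControl hf.mono hyZ ?_
    have := (hnf y hyZ).1
    have := hd y hyZ
    nlinarith
  · have hne : deriv f y ≠ 0 := by
      rw [Ne, hcrit]
      rintro ⟨c, hc, k, rfl⟩
      have hc1 := hsub hc
      have hk : k = 0 := by
        have h1 : (k : ℝ) < 1 := by linarith [hy.2, hc1.1]
        have h2 : (-1 : ℝ) < k := by linarith [hy.1, hc1.2]
        norm_cast at h1 h2
        omega
      exact hyZ (by simpa [hk] using hc)
    have hpos : 0 < deriv f y := lt_of_le_of_ne hf.mono.monotone.deriv_nonneg hne.symm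
    obtain ⟨r, L, hb, -⟩ := exists_hasLocalBounds hf.smooth.contDiffOn isOpen_univ
      (mem_univ y) (half_lt_self hpos) (lt_add_one _) univ_mem
    exact ⟨r, hb.pos, hb.distortionControl hf.mono (half_pos hpos) Z hK⟩

lemma IsCircleMapLift.exists_slope_le {f : ℝ → ℝ} (hf : IsCircleMapLift f) {δ C : ℝ} (hδ : 0 < δ)
    (hδ1 : δ ≤ 1) (hC0 : 0 ≤ C) (hC : ∀ a s t e, e - a ≤ δ → a ≤ s → s < t → t ≤ e →
      (f t - f s) * (e - a) ≤ C * (f e - f a) * (t - s)) :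
    ∃ M, ∀ a s t e, δ ≤ e - a → e - a ≤ 3 → a ≤ s → s < t → t ≤ e →
      (f t - f s) * (e - a) ≤ M * (f e - f a) * (t - s) := by
  have hcont : Continuous f := hf.smooth.continuous
  obtain ⟨x₀, -, hx₀⟩ := isCompact_Icc.exists_isMinOn (nonempty_Icc.2 zero_le_one)
    ((hcont.comp (continuous_add_const δ)).sub hcont).continuousOn (s := Icc (0 : ℝ) 1)
  set μ := f (x₀ + δ) - f x₀ with hμ
  have hμ0 : 0 < μ := sub_pos.2 (hf.mono (by linarith))
  have hmin : ∀ a, μ ≤ f (a + δ) - f a := by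
    intro a
    have h1 : μ ≤ f (Int.fract a + δ) - f (Int.fract a) :=
      hx₀ (show Int.fract a ∈ Icc (0 : ℝ) 1 from ⟨Int.fract_nonneg a, (Int.fract_lt_one a).le⟩)
    have h2 := hf.add_int (Int.fract a) ⌊a⌋
    have h3 := hf.add_int (Int.fract a + δ) ⌊a⌋
    rw [add_right_comm, Int.fract_add_floor] at h3
    rw [Int.fract_add_floor] at h2
    linarith
  have h4 : ∀ s t, t ≤ s + 4 → f t - f s ≤ 4 := by
    intro s t hst
    have h1 := hf.mono.monotone hst
    have h2 := hf.add_int s 4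
    push_cast at h2
    linarith
  have hlip : ∃ Λ, 0 ≤ Λ ∧ ∀ s t, s < t → t ≤ s + 3 → f t - f s ≤ Λ * (t - s) := by
    refine ⟨4 * (C + 1) / δ, by positivity, fun s t hst hts => ?_⟩
    have hts0 := sub_pos.2 hst
    rw [div_mul_eq_mul_div, le_div_iff₀ hδ]
    rcases le_total t (s + δ) with ht | ht
    · have h1 := hC s s t (s + δ) (by linarith) le_rfl hst ht
      have h2 := mul_le_mul_of_nonneg_left (h4 s (s + δ) (by linarith)) hC0
      have h3 := mul_le_mul_of_nonneg_right h2 hts0.le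
      rw [add_sub_cancel_left] at h1
      linarith
    · have h1 := mul_le_mul_of_nonneg_right (h4 s t (by linarith)) hδ.le
      have h2 : 0 ≤ C * (t - s) := by positivity
      linarith
  obtain ⟨Λ, hΛ, hlip⟩ := hlip
  refine ⟨3 * Λ / μ, fun a s t e hδe he3 has hst hte => ?_⟩
  have h5 : μ ≤ f e - f a := (hmin a).trans
    (sub_le_sub_right (hf.mono.monotone (by linarith)) _)
  have hts := sub_pos.2 hst
  calc (f t - f s) * (e - a) ≤ (Λ * (t - s)) * 3 :=
        mul_le_mul (hlip s t hst (by linarith)) he3 (by linarith) (by positivity)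
    _ = 3 * Λ / μ * μ * (t - s) := by field_simp
    _ ≤ 3 * Λ / μ * (f e - f a) * (t - s) := by gcongr

end MCircle

namespace MCircle

/-! ### Global cross-ratio bounds and flatness -/

lemma IsMulticriticalLift.exists_hasCrossRatioBound {f : ℝ → ℝ} {Z : Finset ℝ} {dc : ℝ → ℝ}
    (h : IsMulticriticalLift f Z dc) {d : ℝ} (hd : ∀ c ∈ Z, dc c ≤ d) (h1d : 1 < d) :
    ∃ C, HasCrossRatioBound f Z (4 * d ^ 2) C := by
  have hf := h.1
  have hK : 1 ≤ 4 * d ^ 2 := by nlinarith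
  obtain ⟨δ₀, hδ₀, C₀, hC₀⟩ := h.exists_distortionControl hd h1d
  obtain ⟨δ, hδ, hδ1, C, hC0, hC⟩ : ∃ δ > 0, δ ≤ 1 ∧ ∃ C ≥ 0, ∀ a e, a < e → e - a ≤ δ →
      DistortionControl f Z (4 * d ^ 2) C a e :=
    ⟨min δ₀ 1, lt_min hδ₀ one_pos, min_le_right _ _, max C₀ 0, le_max_right _ _,
      fun a e hae he => (hC₀ a e hae (he.trans (min_le_left _ _))).mono hf.mono (by linarith)
        (le_max_left _ _)⟩
  obtain ⟨M₀, hM₀⟩ := hf.exists_slope_le hδ hδ1 hC0 fun a s t e he has hst hte =>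
    (hC a e (by linarith) he).slope_le s t has hst hte
  set M := max C M₀ with hM
  have hslope : ∀ a s t e, e - a ≤ 3 → a ≤ s → s < t → t ≤ e →
      (f t - f s) * (e - a) ≤ M * (f e - f a) * (t - s) := by
    intro a s t e he has hst hte
    have hfae : 0 ≤ f e - f a := sub_nonneg.2 (hf.mono.monotone (by linarith))
    have hts := (sub_pos.2 hst).le
    rcases le_total (e - a) δ with h1 | h1
    · exact ((hC a e (by linarith) h1).slope_le s t has hst hte).trans
        (by gcongr; exact le_max_left _ _)
    · exact (hM₀ a s t e h1 he has hst hte).trans (by gcongr; exact le_max_right _ _)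
  have hlarge : ∀ a b c e, a < b → b < c → c < e → e - a ≤ 3 → δ ≤ e - a →
      crossRatio (f a) (f b) (f c) (f e) ≤
        Real.exp (max C (M ^ 2 / δ ^ 2) * (e - a) ^ 2) * crossRatio a b c e := by
    intro a b c e hab hbc hce he hδe
    refine (crossRatio_le_of_slope_le (hf.mono.strictMonoOn _) hab hbc hce
      (hslope a a b c (by linarith) le_rfl hab hbc.le)
      (hslope b c e e (by linarith) hbc.le hce le_rfl)).trans
      (mul_le_mul_of_nonneg_right ?_ (crossRatio_pos hab hbc hce).le)
    have h1 : M ^ 2 ≤ max C (M ^ 2 / δ ^ 2) * (e - a) ^ 2 := by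
      calc M ^ 2 = M ^ 2 / δ ^ 2 * δ ^ 2 := by field_simp
        _ ≤ max C (M ^ 2 / δ ^ 2) * (e - a) ^ 2 := by
          gcongr
          exact le_max_right _ _
    have h2 := Real.add_one_le_exp (max C (M ^ 2 / δ ^ 2) * (e - a) ^ 2)
    linarith
  refine ⟨max C (M ^ 2 / δ ^ 2), hK, hC0.trans (le_max_left _ _),
    fun a b c e hab hbc hce he => ?_, fun a b c e hab hbc hce he hdis => ?_⟩
  · have hae : a < e := by linarith
    rcases le_total (e - a) δ with h1 | h1
    · exact ((hC a e hae h1).mono hf.mono (by linarith) (le_max_left _ _)).le b c hab hbc hce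
    · refine (hlarge a b c e hab hbc hce he h1).trans ?_
      have := crossRatio_pos hab hbc hce
      rw [mul_assoc (4 * d ^ 2)]
      exact le_mul_of_one_le_left (by positivity) hK
  · have hae : a < e := by linarith
    rcases le_total (e - a) δ with h1 | h1
    · exact ((hC a e hae h1).mono hf.mono (by linarith) (le_max_left _ _)).le_of_disjoint hdis
        b c hab hbc hce
    · exact hlarge a b c e hab hbc hce he h1

lemma exists_abs_sub_le_sq {f : ℝ → ℝ} (hf : ContDiff ℝ 3 f) {c : ℝ} (hc : deriv f c = 0) :
    ∃ r > 0, ∃ L, ∀ x, c ≤ x → x < c + r → |f x - f c| ≤ L * (x - c) ^ 2 := by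
  obtain ⟨r, L, hb, -⟩ := exists_hasLocalBounds hf.contDiffOn isOpen_univ (mem_univ c)
    (show -1 < deriv f c by rw [hc]; norm_num) (show deriv f c < 1 by rw [hc]; norm_num) univ_mem
  have hr := hb.pos
  refine ⟨r, hr, L, fun x hx hxr => ?_⟩
  have hmem : ∀ {t}, t ∈ Icc c x → t ∈ Ioo (c - r) (c + r) := fun ht =>
    ⟨by linarith [ht.1], by linarith [ht.2]⟩
  have h1 : ∀ t ∈ Icc c x, |deriv f t - 0| ≤ L * (x - c) := by
    intro t ht
    have := abs_sub_sub_le_of_hasDerivAt (k := 0) (C := L)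
      (fun s hs => hb.hasDerivAt_deriv s (hmem hs))
      (fun s hs => by simpa using hb.abs_deriv_deriv_le s (hmem hs)) le_rfl ht.1 ht.2
    rw [hc, sub_zero, zero_mul, sub_zero] at this
    rw [sub_zero]
    exact this.trans (mul_le_mul_of_nonneg_left (by linarith [ht.2]) hb.nonneg)
  have := abs_sub_sub_le_of_hasDerivAt (fun s hs => hb.hasDerivAt s (hmem hs)) h1 le_rfl hx le_rfl
  rw [zero_mul, sub_zero] at this
  linarith

lemma two_le_of_rpow_le {m L δ r : ℝ} (hm : 0 < m) (hr : 0 < r)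
    (h : ∀ t, 0 < t → t < r → (m * t) ^ δ ≤ L * t ^ 2) : 2 ≤ δ := by
  by_contra! hδ
  have h1 : Tendsto (fun t : ℝ => t ^ (2 - δ)) (𝓝[>] 0) (𝓝 0) := by
    have := (Real.continuousAt_rpow_const 0 (2 - δ) (Or.inr (by linarith))).tendsto
    rw [Real.zero_rpow (by linarith)] at this
    exact this.mono_left nhdsWithin_le_nhds
  have h2 := h1.const_mul L
  rw [mul_zero] at h2
  refine (Real.rpow_pos_of_pos hm δ).not_ge (ge_of_tendsto h2 ?_)
  filter_upwards [Ioo_mem_nhdsGT hr] with t ht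
  have h3 := h t ht.1 ht.2
  rw [Real.mul_rpow hm.le ht.1.le] at h3
  have h4 := Real.rpow_pos_of_pos ht.1 δ
  rw [Real.rpow_sub ht.1, Real.rpow_two, ← mul_div_assoc, le_div_iff₀ h4]
  exact h3

/-- Near a critical point of a `C³` map, increments are controlled quadratically: this holds because
the criticality is at least `2`. -/
lemma IsNonFlatCritPt.exists_flat {f : ℝ → ℝ} (hf : IsCircleMapLift f) {c δ : ℝ}
    (h : IsNonFlatCritPt f c δ) (hc : deriv f c = 0) :
    ∃ r > 0, ∀ x y, |x - c| ≤ r → |y - c| ≤ r → 2 * |x - c| ≤ |y - c| →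
      |f x - f c| * |y - c| ^ 2 ≤ 4 * |x - c| ^ 2 * |f y - f c| := by
  obtain ⟨φ, r, L, m, M, hb, hm, hMm, hφc, hfφ⟩ := h.exists_hasLocalBounds hf.mono
  have hr := hb.pos
  have hδ : 1 < δ := h.1
  have hM : 0 < M := hm.trans_le
    ((hb.le_deriv c ⟨by linarith, by linarith⟩).trans (hb.deriv_le c ⟨by linarith, by linarith⟩))
  have habs : ∀ x ∈ Ioo (c - r) (c + r), |f x - f c| = |φ x| ^ δ := fun x hx => by
    rw [hfφ x hx, add_sub_cancel_left, abs_powerMap hδ]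
  have hφ : ∀ x ∈ Ioo (c - r) (c + r), m * |x - c| ≤ |φ x| ∧ |φ x| ≤ M * |x - c| := by
    intro x hx
    rcases lt_trichotomy x c with hxc | rfl | hxc
    · have := hb.slope_bounds hx.1 hxc (by linarith)
      rw [hφc] at this
      have : 0 < m * (c - x) := mul_pos hm (by linarith)
      rw [abs_of_neg (show x - c < 0 by linarith), abs_of_neg (show φ x < 0 by linarith)]
      constructor <;> linarith
    · simp [hφc]
    · have := hb.slope_bounds (by linarith) hxc hx.2
      rw [hφc] at this
      have : 0 < m * (x - c) := mul_pos hm (by linarith)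
      rw [abs_of_pos (show 0 < x - c by linarith), abs_of_pos (show 0 < φ x by linarith)]
      constructor <;> linarith
  obtain ⟨r', hr', L', hL'⟩ := exists_abs_sub_le_sq hf.smooth hc
  have hδ2 : 2 ≤ δ := by
    refine two_le_of_rpow_le hm (lt_min hr hr') (L := L') fun t ht htr => ?_
    have hx : c + t ∈ Ioo (c - r) (c + r) :=
      ⟨by linarith, by linarith [htr.trans_le (min_le_left _ _)]⟩
    have h1 := hL' (c + t) (by linarith) (by linarith [htr.trans_le (min_le_right _ _)])
    have h2 := (hφ _ hx).1
    rw [add_sub_cancel_left] at h1 h2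
    rw [abs_of_pos ht] at h2
    rw [habs _ hx] at h1
    exact (Real.rpow_le_rpow (by positivity) h2 (by linarith)).trans h1
  refine ⟨r / 2, half_pos hr, fun x y hx hy hxy => ?_⟩
  have hmem : ∀ {z}, |z - c| ≤ r / 2 → z ∈ Ioo (c - r) (c + r) := fun hz =>
    ⟨by linarith [(abs_le.1 hz).1], by linarith [(abs_le.1 hz).2]⟩
  rcases (abs_nonneg (y - c)).eq_or_lt with hy0 | hy0
  · rw [← hy0]; simp only [ne_eq, OfNat.ofNat_ne_zero, not_false_eq_true, zero_pow, mul_zero]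
    positivity
  rw [habs x (hmem hx), habs y (hmem hy)]
  set θ := 2 * |x - c| / |y - c| with hθ
  have hθ0 : 0 ≤ θ := by positivity
  have hθ1 : θ ≤ 1 := (div_le_one hy0).2 hxy
  have h1 : |φ x| ≤ θ * |φ y| := by
    rw [hθ, div_mul_eq_mul_div, le_div_iff₀ hy0]
    calc |φ x| * |y - c| ≤ (2 * m * |x - c|) * |y - c| := by
          gcongr
          exact (hφ x (hmem hx)).2.trans (by gcongr)
      _ = 2 * |x - c| * (m * |y - c|) := by ring
      _ ≤ 2 * |x - c| * |φ y| := by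
          gcongr
          exact (hφ y (hmem hy)).1
  have h2 : |φ x| ^ δ ≤ θ ^ 2 * |φ y| ^ δ := by
    refine (Real.rpow_le_rpow (abs_nonneg _) h1 (by linarith)).trans ?_
    rw [Real.mul_rpow hθ0 (abs_nonneg _)]
    refine mul_le_mul_of_nonneg_right ?_ (by positivity)
    rw [← Real.rpow_two]
    exact Real.rpow_le_rpow_of_exponent_ge_of_imp hθ0 hθ1 hδ2 (by intro _ h; linarith)
  calc |φ x| ^ δ * |y - c| ^ 2 ≤ θ ^ 2 * |φ y| ^ δ * |y - c| ^ 2 := by gcongr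
    _ = _ := by rw [hθ]; field_simp; ring

end MCircle

namespace MCircle

/-! ### Scaling ratios -/

lemma chainBound_image_neg (Z : Finset ℝ) (K C η : ℝ) :
    chainBound (Z.image (- ·)) K C η = chainBound Z K C η := by
  rw [chainBound, chainBound, Finset.card_image_of_injective _ neg_injective]

lemma one_le_adjBound {B : ℝ} (hB : 1 ≤ B) : 1 ≤ adjBound B :=
  one_le_mul_of_one_le_of_one_le hB (one_le_pow₀ (by linarith))

lemma adjBound_mono {B B' : ℝ} (hB : 0 ≤ B) (hBB' : B ≤ B') : adjBound B ≤ adjBound B' := by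
  have hB' : 0 ≤ B' := hB.trans hBB'
  unfold adjBound
  gcongr

lemma le_scalingBound {A B : ℝ} (hB : 1 ≤ B) (hA : 1 ≤ A) : 4 * A ≤ scalingBound B A := by
  have h1 : 1 ≤ (2 + A) * (1 + A) := by nlinarith
  have h2 : A ≤ A * (2 + A) * (1 + A) := by
    rw [mul_assoc]; exact le_mul_of_one_le_right (by linarith) h1
  have h3 : 1 * (A * (2 + A) * (1 + A)) ≤ B * (A * (2 + A) * (1 + A)) := by gcongr
  unfold scalingBound
  linarith

/-- Consecutive steps of orbits of `g` have comparable lengths. -/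
def ComparableSteps (A : ℝ) (g : ℝ → ℝ) : Prop :=
  ∀ x, |g x - x| ≤ A * |g (g x) - g x| ∧ |g (g x) - g x| ≤ A * |g x - x|

lemma abs_liftRet_reflect_sub (f : ℝ → ℝ) (q : ℕ) (p : ℤ) (x : ℝ) :
    |liftRet (reflect f) q (-p) x - x| = |liftRet f q p (-x) - -x| := by
  rw [liftRet_reflect, ← abs_neg]
  congr 1
  ring

lemma ComparableSteps.of_reflect {A : ℝ} {f : ℝ → ℝ} {q : ℕ} {p : ℤ}
    (h : ComparableSteps A (liftRet (reflect f) q (-p))) : ComparableSteps A (liftRet f q p) := by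
  intro x
  have := h (-x)
  rwa [abs_liftRet_reflect_sub, abs_liftRet_reflect_sub, liftRet_reflect, neg_neg, neg_neg] at this

lemma ComparableSteps.reflect {A : ℝ} {f : ℝ → ℝ} {q : ℕ} {p : ℤ}
    (h : ComparableSteps A (liftRet f q p)) : ComparableSteps A (liftRet (reflect f) q (-p)) := by
  intro x
  rw [abs_liftRet_reflect_sub, abs_liftRet_reflect_sub, liftRet_reflect, neg_neg]
  exact h (-x)

lemma ComparableSteps.mono {A A' : ℝ} {g : ℝ → ℝ} (h : ComparableSteps A g) (hA : A ≤ A') :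
    ComparableSteps A' g := fun x =>
  ⟨(h x).1.trans (by gcongr), (h x).2.trans (by gcongr)⟩

section

variable {f : ℝ → ℝ} {ρ K C η : ℝ} {Z : Finset ℝ} {q Q : ℕ} {p P : ℤ}

lemma arcLen_eq (f : ℝ → ℝ) (ρ x : ℝ) (n : ℕ) :
    arcLen f ρ x n = |liftRet f (qden ρ n) (pnum ρ n) x - x| := by
  simp [arcLen, retPt, liftRet]

namespace IsRotationLike

lemma liftRet_lt (h : IsRotationLike f ρ) (hα : (q : ℝ) * ρ - p < 0) (x : ℝ) :
    liftRet f q p x < x := by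
  simpa [liftRet] using h.liftRet_lt_liftRet (k' := 0) (l' := 0) (by simpa using hα) x

lemma comparableSteps (h : IsRotationLike f ρ) (hc : HasCrossRatioBound f Z K C)
    (r : IsReturnPair ρ q p Q P) (hη : ∀ y, |liftRet f q p y - y| ≤ η) :
    ComparableSteps (adjBound (chainBound Z K C η)) (liftRet f q p) := fun x => by
  rw [abs_of_pos (sub_pos.2 (h.lt_liftRet r.pos _)), abs_of_pos (sub_pos.2 (h.lt_liftRet r.pos _))]
  exact h.adjacent_comparable hc r (fun y => (le_abs_self _).trans (hη y)) x

lemma abs_scaling_of_flat (h : IsRotationLike f ρ) (hc : HasCrossRatioBound f Z K C)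
    (r : IsReturnPair ρ q p Q P) (hη : ∀ y, |liftRet f q p y - y| ≤ η) {B A c : ℝ}
    (hB : chainBound Z K C η ≤ B) (hA : 1 ≤ A) (hg : ComparableSteps A (liftRet f q p))
    (hv : ComparableSteps A (liftRet f Q P))
    (hflat : ∀ x y, |x - c| ≤ η → |y - c| ≤ η → 2 * |x - c| ≤ |y - c| →
      |f x - f c| * |y - c| ^ 2 ≤ 4 * |x - c| ^ 2 * |f y - f c|) :
    |liftRet f Q P c - c| ≤ A * |liftRet f q p c - c| ∧
      |liftRet f q p c - c| ≤ scalingBound B A * |liftRet f Q P c - c| := by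
  have hg' : ∀ x, |liftRet f q p x - x| = liftRet f q p x - x := fun x =>
    abs_of_pos (sub_pos.2 (h.lt_liftRet r.pos x))
  have hv' : ∀ x, |liftRet f Q P x - x| = x - liftRet f Q P x := fun x => by
    rw [abs_sub_comm, abs_of_pos (sub_pos.2 (h.liftRet_lt r.next_neg x))]
  simp only [ComparableSteps, hg', hv'] at hg hv hη ⊢
  exact h.scaling_of_flat hc r hη hB hA (fun x => (hg x).1) (fun x => (hv x).1)
    (fun x => (hv x).2) hflat

lemma abs_liftRet_sub_le_one (h : IsRotationLike f ρ) (r : IsReturnPair ρ q p Q P) (x : ℝ) :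
    |liftRet f q p x - x| ≤ 1 := by
  rw [abs_of_pos (sub_pos.2 (h.lt_liftRet r.pos _))]
  linarith [h.liftRet_lt_add_one r.lt_one x]

lemma displacement_small_of_isReturnPair (h : IsRotationLike f ρ) (hc : HasCrossRatioBound f Z K C)
    {q Q : ℕ → ℕ} {p P : ℕ → ℤ} (r : ∀ n, IsReturnPair ρ (q n) (p n) (Q n) (P n))
    (hanti : Antitone fun n => (q n : ℝ) * ρ - p n)
    (hlim : ∀ n, (q n : ℝ) * ρ - p n ≤ (1 / 2) ^ n) (hη : 0 < η) :
    ∃ n₀, ∀ n ≥ n₀, ∀ x, |liftRet f (q n) (p n) x - x| ≤ η := by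
  have hB : 0 < adjBound (chainBound Z K C 1) :=
    one_pos.trans_le (one_le_adjBound (one_le_chainBound hc.one_le hc.nonneg zero_le_one))
  have hpos : ∀ n x, |liftRet f (q n) (p n) x - x| = liftRet f (q n) (p n) x - x := fun n x =>
    abs_of_pos (sub_pos.2 (h.lt_liftRet (r n).pos x))
  simp only [hpos]
  refine h.displacement_small q p (fun n => (r n).pos) hanti
    (squeeze_zero (fun n => (r n).pos.le) hlim
      (tendsto_pow_atTop_nhds_zero_of_lt_one (by norm_num) (by norm_num))) hB (fun n x => ?_) hη
  have := (h.comparableSteps hc (r n) (h.abs_liftRet_sub_le_one (r n)) x).1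
  rwa [hpos, hpos] at this

lemma arcLen_pos (h : IsRotationLike f ρ) (hirr : Irrational ρ) (hρ : ρ ∈ Ioo (0 : ℝ) 1) (x : ℝ)
    (n : ℕ) : 0 < arcLen f ρ x n := by
  rw [arcLen_eq, abs_pos, sub_ne_zero]
  have hs := cfDisp_sign hirr hρ n
  rw [cfDisp] at hs
  rcases n.even_or_odd with hn | hn
  · rw [hn.neg_one_pow] at hs
    exact (h.lt_liftRet (by push_cast; linarith) x).ne'
  · rw [hn.neg_one_pow] at hs
    exact (h.liftRet_lt (by push_cast; linarith) x).ne

lemma exists_displacement_le (h : IsRotationLike f ρ) (hc : HasCrossRatioBound f Z K C)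
    (hirr : Irrational ρ) (hρ : ρ ∈ Ioo (0 : ℝ) 1) (hη : 0 < η) :
    ∃ n₀, ∀ n ≥ n₀, ∀ x, |liftRet f (qden ρ n) (pnum ρ n) x - x| ≤ η := by
  have hanti : ∀ i, Antitone fun n => |cfDisp ρ (2 * n + i)| := fun i =>
    antitone_nat_of_succ_le fun n => by
      have := abs_cfDisp_add_two_le hirr hρ (2 * n + i)
      rw [show 2 * (n + 1) + i = 2 * n + i + 2 by ring]
      linarith [abs_nonneg (cfDisp ρ (2 * n + i))]
  have heven : ∀ n : ℕ, (qden ρ (2 * n + 0) : ℝ) * ρ - (pnum ρ (2 * n + 0) : ℤ) =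
      |cfDisp ρ (2 * n + 0)| := fun n => by
    rw [abs_cfDisp hirr hρ, Even.neg_one_pow (by simp), cfDisp]
    push_cast
    ring
  have hodd : ∀ n : ℕ, (qden ρ (2 * n + 1) : ℝ) * -ρ - (-(pnum ρ (2 * n + 1) : ℤ) : ℤ) =
      |cfDisp ρ (2 * n + 1)| := fun n => by
    rw [abs_cfDisp hirr hρ, Odd.neg_one_pow (by simp), cfDisp]
    push_cast
    ring
  obtain ⟨n₀, hn₀⟩ := h.displacement_small_of_isReturnPair hc
    (fun n => isReturnPair_of_even hirr hρ (n := 2 * n + 0) (by simp))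
    (by simpa only [heven] using hanti 0)
    (by simpa only [heven] using abs_cfDisp_two_mul_add_le hirr hρ 0) hη
  obtain ⟨n₁, hn₁⟩ := h.reflect.displacement_small_of_isReturnPair hc.reflect
    (fun n => isReturnPair_of_odd hirr hρ (n := 2 * n + 1) (by simp))
    (by simpa only [hodd] using hanti 1)
    (by simpa only [hodd] using abs_cfDisp_two_mul_add_le hirr hρ 1) hη
  refine ⟨2 * (n₀ + n₁) + 1, fun n hn x => ?_⟩
  obtain ⟨k, rfl | rfl⟩ := n.even_or_odd'
  · exact hn₀ k (by omega) x
  · have := hn₁ k (by omega) (-x)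
    rwa [abs_liftRet_reflect_sub, neg_neg] at this

lemma comparableSteps_of_displacement_le (h : IsRotationLike f ρ)
    (hc : HasCrossRatioBound f Z K C) (hirr : Irrational ρ) (hρ : ρ ∈ Ioo (0 : ℝ) 1) {n : ℕ}
    (hη : ∀ x, |liftRet f (qden ρ n) (pnum ρ n) x - x| ≤ η) :
    ComparableSteps (adjBound (chainBound Z K C η)) (liftRet f (qden ρ n) (pnum ρ n)) := by
  rcases n.even_or_odd with hn | hn
  · exact h.comparableSteps hc (isReturnPair_of_even hirr hρ hn) hη
  · refine ComparableSteps.of_reflect ?_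
    rw [← chainBound_image_neg]
    exact h.reflect.comparableSteps hc.reflect (isReturnPair_of_odd hirr hρ hn) fun y => by
      rw [abs_liftRet_reflect_sub]
      exact hη (-y)

lemma abs_scaling_of_displacement_le (h : IsRotationLike f ρ) (hc : HasCrossRatioBound f Z K C)
    (hirr : Irrational ρ) (hρ : ρ ∈ Ioo (0 : ℝ) 1) {n : ℕ}
    (hη : ∀ x, |liftRet f (qden ρ n) (pnum ρ n) x - x| ≤ η)
    (hη' : ∀ x, |liftRet f (qden ρ (n + 1)) (pnum ρ (n + 1)) x - x| ≤ η) {B c : ℝ}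
    (hB : chainBound Z K C η ≤ B)
    (hflat : ∀ x y, |x - c| ≤ η → |y - c| ≤ η → 2 * |x - c| ≤ |y - c| →
      |f x - f c| * |y - c| ^ 2 ≤ 4 * |x - c| ^ 2 * |f y - f c|) :
    arcLen f ρ c (n + 1) ≤ adjBound B * arcLen f ρ c n ∧
      arcLen f ρ c n ≤ scalingBound B (adjBound B) * arcLen f ρ c (n + 1) := by
  have hη0 : 0 ≤ η := (abs_nonneg _).trans (hη 0)
  have hB1 := one_le_chainBound (Z := Z) hc.one_le hc.nonneg hη0
  have hA := one_le_adjBound (hB1.trans hB)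
  have hmono := adjBound_mono (by linarith) hB
  have hg := (h.comparableSteps_of_displacement_le hc hirr hρ hη).mono hmono
  have hv := (h.comparableSteps_of_displacement_le hc hirr hρ hη').mono hmono
  rw [arcLen_eq, arcLen_eq]
  rcases n.even_or_odd with hn | hn
  · exact h.abs_scaling_of_flat hc (isReturnPair_of_even hirr hρ hn) hη hB hA hg hv hflat
  · have := h.reflect.abs_scaling_of_flat (B := B) (c := -c) hc.reflect
      (isReturnPair_of_odd hirr hρ hn)
      (fun y => by rw [abs_liftRet_reflect_sub]; exact hη (-y))
      (by rwa [chainBound_image_neg]) hA hg.reflect hv.reflect fun x y => by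
        have e : ∀ s t : ℝ, |s - -t| = |-s - t| := fun s t => by
          rw [← abs_neg]; congr 1; ring
        simp only [MCircle.reflect, neg_neg, e]
        exact hflat (-x) (-y)
    rwa [abs_liftRet_reflect_sub, abs_liftRet_reflect_sub, neg_neg] at this

end IsRotationLike

end

lemma chainBound_le {Z : Finset ℝ} {K C η : ℝ} {N : ℕ} (hK : 1 ≤ K) (hZ : Z.card ≤ N)
    (hη : 18 * C * η ≤ 1) : chainBound Z K C η ≤ K ^ (6 * N) * Real.exp 1 := by
  unfold chainBound
  gcongr

end MCircle

open MCircle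

/-- **Beau bounds for scaling ratios** (Theorem 1.1). Given `N ≥ 1` and `d > 1` there
is `B = B(N,d) > 1` such that for every multicritical circle map `f` with irrational
rotation number, having at most `N` critical points with criticalities at most `d`,
and every critical point `c` of `f`, there is `n₀ = n₀(f)` such that for all `n ≥ n₀`
the scaling ratio around `c` satisfies `B⁻¹ ≤ |I_{n+1}(c)|/|Iₙ(c)| ≤ B`. -/
theorem beau_scaling_ratios (N : ℕ) (hN : 1 ≤ N) (d : ℝ) (hd : 1 < d) :
    ∃ B : ℝ, 1 < B ∧
      ∀ (f : ℝ → ℝ) (C : Finset ℝ) (dc : ℝ → ℝ) (ρ : ℝ),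
        GoodMap f C dc ρ → C.card ≤ N → (∀ c ∈ C, dc c ≤ d) →
        ∀ c ∈ C, ∃ n₀ : ℕ, ∀ n ≥ n₀,
          B⁻¹ ≤ arcLen f ρ c (n + 1) / arcLen f ρ c n ∧
          arcLen f ρ c (n + 1) / arcLen f ρ c n ≤ B := by
  have hK : 1 ≤ 4 * d ^ 2 := by nlinarith
  set B := (4 * d ^ 2) ^ (6 * N) * Real.exp 1
  have hB : 1 ≤ B := one_le_mul_of_one_le_of_one_le (one_le_pow₀ hK) (Real.one_le_exp zero_le_one)
  have hA := one_le_adjBound hB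
  have hAS := le_scalingBound hB hA
  set S := scalingBound B (adjBound B)
  have hS : 1 < S := by linarith
  refine ⟨S, hS, ?_⟩
  rintro f Z dc ρ ⟨hf, hrot, hirr, hρ⟩ hZ hdc c hc
  have h := isRotationLike_of_hasRotNumber hf.1 hrot hirr
  obtain ⟨C, hC⟩ := hf.exists_hasCrossRatioBound hdc hd
  obtain ⟨r, hr, hflat⟩ := (hf.2.2.2.2 c hc).exists_flat hf.1
    ((hf.2.2.2.1 c).2 ⟨c, hc, 0, by simp⟩)
  have hC1 : 0 < 18 * C + 1 := by linarith [hC.nonneg]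
  set η := min r (1 / (18 * C + 1))
  have hη : 0 < η := lt_min hr (by positivity)
  have hCη : 18 * C * η ≤ 1 := by
    have h1 : η ≤ 1 / (18 * C + 1) := min_le_right _ _
    rw [le_div_iff₀ hC1] at h1
    linarith
  obtain ⟨n₀, hn₀⟩ := h.exists_displacement_le hC hirr hρ hη
  refine ⟨n₀, fun n hn => ?_⟩
  obtain ⟨h1, h2⟩ := h.abs_scaling_of_displacement_le hC hirr hρ (c := c) (hn₀ n hn)
    (hn₀ (n + 1) (by omega)) (chainBound_le hK hZ hCη)
    fun x y hx hy => hflat x y (hx.trans (min_le_left _ _)) (hy.trans (min_le_left _ _))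
  have hpos : 0 < arcLen f ρ c n := h.arcLen_pos hirr hρ c n
  have hS0 : 0 < S := by linarith
  constructor
  · rw [le_div_iff₀ hpos, inv_mul_le_iff₀ hS0]
    exact h2
  · rw [div_le_iff₀ hpos]
    exact h1.trans (mul_le_mul_of_nonneg_right (by linarith) hpos.le)
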